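/- (Cayley–Hamilton theorem.) Let R̂ be an even Hecke R-matrix of height n for the parameter q with m_q ≠ 0 for all m ≥ 1, let F̂ be a closed R-matrix compatible with R̂ whose matrix D is invertible, and let M be a matrix of generators of M(R̂,F̂) over a unital associative k-algebra A. Then Σ_{i=0}^{n} (−q)^i M^{‾(n−i)} σ_i(M) = 0 as an N×N matrix over A, where M^{‾0} := q^{−n} n_q · Tr_{(2,…,n)}(A^{(n)}) · D^{−1} (ordinary trace over the factors 2,…,n). -/

import Mathlib

/-! Common definitions for quantum matrix algebras `M(R̂,F̂)` in the sense of
Isaev–Ogievetsky–Pyatov, "On quantum matrix algebras satisfying the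
Cayley-Hamilton-Newton identities".

We model operators on `V^{⊗m}` (where `dim V = N`) as matrices indexed by
multi-indices `Fin m → Fin N`; entries are taken in a (possibly
noncommutative) unital associative algebra `A` over a field `K`.
Sites (tensor factors) are numbered starting from `0`, so the paper's
`X_i` is `site m (i-1) X`, and the paper's `M_{\overline{k}}` is
`Mbar m F F⁻¹ M (k-1)`. -/

namespace CHN

noncomputable section

/-- Operators on `V^{⊗m}` (`dim V = N`) with entries in a ring `A`. -/
abbrev Op (N : ℕ) (A : Type*) [Ring A] (m : ℕ) :=
  Matrix (Fin m → Fin N) (Fin m → Fin N) A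

/-- Operators on `V ⊗ V`. -/
abbrev M2 (N : ℕ) (A : Type*) [Ring A] :=
  Matrix (Fin N × Fin N) (Fin N × Fin N) A

/-- `site m i X` places the two-site operator `X` at the (0-based) tensor
factors `i, i+1` of `V^{⊗m}`, acting as the identity elsewhere.  In the
paper's 1-based notation, `X_i = site m (i-1) X`.  (Out of range it is the
identity.) -/
def site {A : Type*} [Ring A] {N : ℕ} (m i : ℕ) (X : M2 N A) : Op N A m :=
  fun a b =>
    if h : i + 1 < m then
      X (a ⟨i, Nat.lt_of_succ_lt h⟩, a ⟨i + 1, h⟩)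
          (b ⟨i, Nat.lt_of_succ_lt h⟩, b ⟨i + 1, h⟩) *
        (if ∀ j : Fin m, (j : ℕ) ≠ i → (j : ℕ) ≠ i + 1 → a j = b j then 1 else 0)
    else if a = b then 1 else 0

/-- `site1 m i X` places the one-site operator `X` at the (0-based) factor `i`. -/
def site1 {A : Type*} [Ring A] {N : ℕ} (m i : ℕ) (X : Matrix (Fin N) (Fin N) A) :
    Op N A m :=
  fun a b =>
    if h : i < m then
      X (a ⟨i, h⟩) (b ⟨i, h⟩) *
        (if ∀ j : Fin m, (j : ℕ) ≠ i → a j = b j then 1 else 0)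
    else if a = b then 1 else 0

/-- `chain m X i l = X_i X_{i+1} ⋯ X_{i+l-1}` (0-based sites, `l` factors); in
the paper's 1-based notation this is `X_{i+1 → i+l}`. -/
def chain {A : Type*} [Ring A] {N : ℕ} (m : ℕ) (X : M2 N A) (i : ℕ) :
    ℕ → Op N A m
  | 0 => 1
  | l + 1 => chain m X i l * site m (i + l) X

/-- The Yang–Baxter equation `X₁X₂X₁ = X₂X₁X₂` on `V^{⊗3}`. -/
def YB {A : Type*} [Ring A] {N : ℕ} (X : M2 N A) : Prop :=
  site 3 0 X * site 3 1 X * site 3 0 X = site 3 1 X * site 3 0 X * site 3 1 X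

/-- Compatibility of a pair of R-matrices: both Yang–Baxter equations together
with the conditions `R̂₁F̂₂F̂₁ = F̂₂F̂₁R̂₂` and `F̂₁F̂₂R̂₁ = R̂₂F̂₁F̂₂` on `V^{⊗3}`. -/
def Compatible {A : Type*} [Ring A] {N : ℕ} (R F : M2 N A) : Prop :=
  YB R ∧ YB F ∧
    site 3 0 R * site 3 1 F * site 3 0 F = site 3 1 F * site 3 0 F * site 3 1 R ∧
    site 3 0 F * site 3 1 F * site 3 0 R = site 3 1 R * site 3 0 F * site 3 1 F

/-- `Ψ` witnesses closedness of `F̂`:  `Ψ^{af}_{cg} F̂^{gb}_{fd} = δ^a_d δ^b_c`. -/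
def IsClosedPair {A : Type*} [Ring A] {N : ℕ} (F Ψ : M2 N A) : Prop :=
  ∀ a b c d : Fin N,
    (∑ f : Fin N, ∑ g : Fin N, Ψ (a, f) (c, g) * F (g, b) (f, d)) =
      if a = d ∧ b = c then 1 else 0

/-- The matrix `D`, `D^a_b := Ψ^{ac}_{bc}`. -/
def Dmat {A : Type*} [Ring A] {N : ℕ} (Ψ : M2 N A) : Matrix (Fin N) (Fin N) A :=
  fun a b => ∑ c : Fin N, Ψ (a, c) (b, c)

/-- Quantum trace (with weight `D`) over the last tensor factor. -/
def qtr1 {K : Type*} [Field K] {A : Type*} [Ring A] [Algebra K A] {N m : ℕ}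
    (D : Matrix (Fin N) (Fin N) K) (X : Op N A (m + 1)) : Op N A m :=
  fun a b => ∑ c : Fin N, ∑ e : Fin N,
    algebraMap K A (D c e) * X (Fin.snoc a e) (Fin.snoc b c)

/-- Quantum trace over the last `j` tensor factors. -/
def qtrs {K : Type*} [Field K] {A : Type*} [Ring A] [Algebra K A] {N : ℕ}
    (D : Matrix (Fin N) (Fin N) K) (m : ℕ) :
    (j : ℕ) → Op N A (m + j) → Op N A m
  | 0, X => X
  | j + 1, X => qtrs D m j (qtr1 D X)

/-- Full quantum trace `Tr_F(1,…,m)`, with values in `A`. -/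
def qtrAll {K : Type*} [Field K] {A : Type*} [Ring A] [Algebra K A] {N m : ℕ}
    (D : Matrix (Fin N) (Fin N) K) (X : Op N A m) : A :=
  ∑ a : Fin m → Fin N, ∑ b : Fin m → Fin N,
    algebraMap K A (∏ i, D (a i) (b i)) * X b a

/-- Quantum trace of a one-site operator:  `Tr_F X = Tr (D X)`. -/
def trF {K : Type*} [Field K] {A : Type*} [Ring A] [Algebra K A] {N : ℕ}
    (D : Matrix (Fin N) (Fin N) K) (X : Matrix (Fin N) (Fin N) A) : A :=
  ∑ a : Fin N, ∑ b : Fin N, algebraMap K A (D a b) * X b a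

/-- Ordinary partial trace over the last tensor factor. -/
def ptr1 {A : Type*} [Ring A] {N m : ℕ} (X : Op N A (m + 1)) : Op N A m :=
  fun a b => ∑ c : Fin N, X (Fin.snoc a c) (Fin.snoc b c)

/-- Ordinary partial trace over the last `j` tensor factors. -/
def ptrs {A : Type*} [Ring A] {N : ℕ} (m : ℕ) :
    (j : ℕ) → Op N A (m + j) → Op N A m
  | 0, X => X
  | j + 1, X => ptrs m j (ptr1 X)

/-- `Mbar m F Finv M k` is the paper's `M_{\overline{k+1}}` (0-based index `k`):
`M_{\overline{1}} := M₁` and `M_{\overline{k+1}} := F̂_k M_{\overline{k}} F̂_k⁻¹`. -/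
def Mbar {A : Type*} [Ring A] {N : ℕ} (m : ℕ) (F Finv : M2 N A)
    (M : Matrix (Fin N) (Fin N) A) : ℕ → Op N A m
  | 0 => site1 m 0 M
  | k + 1 => site m k F * Mbar m F Finv M k * site m k Finv

/-- `MbarSeg m F Finv M i l = M_{\overline{i+1}} M_{\overline{i+2}} ⋯ M_{\overline{i+l}}`,
the ordered product of `l` consecutive copies starting at 0-based index `i`.
In particular `MbarSeg m F Finv M 0 k = M_{\overline{1}} ⋯ M_{\overline{k}}`. -/
def MbarSeg {A : Type*} [Ring A] {N : ℕ} (m : ℕ) (F Finv : M2 N A)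
    (M : Matrix (Fin N) (Fin N) A) (i : ℕ) : ℕ → Op N A m
  | 0 => 1
  | l + 1 => MbarSeg m F Finv M i l * Mbar m F Finv M (i + l)

/-- The double twist `R̂^{FF} = F̂ (F̂ R̂ F̂⁻¹) F̂⁻¹`. -/
def RFF {K : Type*} [Field K] {N : ℕ} (R F : M2 N K) : M2 N K :=
  F * (F * R * F⁻¹) * F⁻¹

/-- `M` is a matrix of generators of the algebra `M(R̂,F̂)`:
`R̂₁ M_{\overline{1}} M_{\overline{2}} = M_{\overline{1}} M_{\overline{2}} (R̂^{FF})₁`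
on `V ⊗ V`. -/
def IsGenerators {K : Type*} [Field K] {A : Type*} [Ring A] [Algebra K A] {N : ℕ}
    (R F : M2 N K) (M : Matrix (Fin N) (Fin N) A) : Prop :=
  site 2 0 (R.map (algebraMap K A)) *
      MbarSeg 2 (F.map (algebraMap K A)) ((F⁻¹).map (algebraMap K A)) M 0 2 =
    MbarSeg 2 (F.map (algebraMap K A)) ((F⁻¹).map (algebraMap K A)) M 0 2 *
      site 2 0 ((RFF R F).map (algebraMap K A))

/-- Evaluation of a noncommutative polynomial `Y` in `v` variables, substituting
for the variable `x_j` the operator `R̂` placed at the (0-based) sites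
`p+j, p+j+1` of `V^{⊗m}`.  For `p = 0` this is the paper's
`Y^{(v+1)} = Y^{(v+1)}(R̂₁,…,R̂_v)`, and a general `p` gives `Y^{(p+1,v+1)}`. -/
def evalY {K : Type*} [Field K] {A : Type*} [Ring A] [Algebra K A] {N m v : ℕ}
    (R : M2 N A) (p : ℕ) (Y : FreeAlgebra K (Fin v)) : Op N A m :=
  FreeAlgebra.lift K (fun j : Fin v => site m (p + (j : ℕ)) R) Y

/-- `Ustack m R k l = R̂_{l → l+k-1} ⋯ R̂_{2 → k+1} R̂_{1 → k}` (1-based labels):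
the product of `l` descending chains of length `k`. -/
def Ustack {A : Type*} [Ring A] {N : ℕ} (m : ℕ) (R : M2 N A) (k : ℕ) :
    ℕ → Op N A m
  | 0 => 1
  | l + 1 => chain m R l k * Ustack m R k l

/-- The `q`-number `n_q = (qⁿ − q⁻ⁿ)/(q − q⁻¹)`. -/
def qInt {K : Type*} [Field K] (q : K) (n : ℕ) : K :=
  (q ^ n - q⁻¹ ^ n) / (q - q⁻¹)

/-- `R̂` is a Hecke R-matrix for the parameter `q`:  it is invertible, satisfies
the Yang–Baxter equation and the Hecke condition `R̂² = 1 + (q − q⁻¹)R̂`. -/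
def IsHecke {K : Type*} [Field K] {N : ℕ} (q : K) (R : M2 N K) : Prop :=
  IsUnit R ∧ YB R ∧ R * R = 1 + (q - q⁻¹) • R

/-- The `q`-antisymmetrizer `A^{(k)}` built from `R̂`, placed at the (0-based)
tensor factors `p, p+1, …, p+k-1` of `V^{⊗m}`. -/
def qasym {K : Type*} [Field K] {N : ℕ} (q : K) (R : M2 N K) (m p : ℕ) :
    ℕ → Op N K m
  | 0 => 1
  | 1 => 1
  | k + 2 =>
      (qInt q (k + 2))⁻¹ •
        (qasym q R m p (k + 1) *
          (q ^ (k + 1) • (1 : Op N K m) - qInt q (k + 1) • site m (p + k) R) *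
          qasym q R m p (k + 1))

/-- The `q`-symmetrizer `S^{(k)}` built from `R̂`, placed at the (0-based)
tensor factors `p, p+1, …, p+k-1` of `V^{⊗m}`. -/
def qsym {K : Type*} [Field K] {N : ℕ} (q : K) (R : M2 N K) (m p : ℕ) :
    ℕ → Op N K m
  | 0 => 1
  | 1 => 1
  | k + 2 =>
      (qInt q (k + 2))⁻¹ •
        (qsym q R m p (k + 1) *
          (q⁻¹ ^ (k + 1) • (1 : Op N K m) + qInt q (k + 1) • site m (p + k) R) *
          qsym q R m p (k + 1))

/-- The elementary symmetric function
`σ_k(M) = Tr_F(1,…,k)(A^{(k)} M_{\overline{1}}⋯M_{\overline{k}})` (with `σ_0 = 1`). -/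
def sigmaF {K : Type*} [Field K] {A : Type*} [Ring A] [Algebra K A] {N : ℕ}
    (q : K) (R F Ψ : M2 N K) (M : Matrix (Fin N) (Fin N) A) (k : ℕ) : A :=
  qtrAll (Dmat Ψ)
    ((qasym q R k 0 k).map (algebraMap K A) *
      MbarSeg k (F.map (algebraMap K A)) ((F⁻¹).map (algebraMap K A)) M 0 k)

/-- The complete symmetric function
`τ_k(M) = Tr_F(1,…,k)(S^{(k)} M_{\overline{1}}⋯M_{\overline{k}})` (with `τ_0 = 1`). -/
def tauF {K : Type*} [Field K] {A : Type*} [Ring A] [Algebra K A] {N : ℕ}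
    (q : K) (R F Ψ : M2 N K) (M : Matrix (Fin N) (Fin N) A) (k : ℕ) : A :=
  qtrAll (Dmat Ψ)
    ((qsym q R k 0 k).map (algebraMap K A) *
      MbarSeg k (F.map (algebraMap K A)) ((F⁻¹).map (algebraMap K A)) M 0 k)

/-- The power sums `s_k(M) = Tr_F(1,…,k)(R̂_{1→k−1} M_{\overline{1}}⋯M_{\overline{k}})`,
with `s_0 = 1`. -/
def sF {K : Type*} [Field K] {A : Type*} [Ring A] [Algebra K A] {N : ℕ}
    (R F Ψ : M2 N K) (M : Matrix (Fin N) (Fin N) A) : ℕ → A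
  | 0 => 1
  | j + 1 =>
      qtrAll (Dmat Ψ)
        (chain (j + 1) (R.map (algebraMap K A)) 0 j *
          MbarSeg (j + 1) (F.map (algebraMap K A)) ((F⁻¹).map (algebraMap K A)) M 0 (j + 1))

/-- The `(j+1)`-st quantum power of `M`,
`M^{\overline{j+1}} = Tr_F(2,…,j+1)(R̂_{1→j} M_{\overline{1}}⋯M_{\overline{j+1}})`,
as a one-site operator (so `MpowF R F Ψ M 0 = M₁ = M`). -/
def MpowF {K : Type*} [Field K] {A : Type*} [Ring A] [Algebra K A] {N : ℕ}
    (R F Ψ : M2 N K) (M : Matrix (Fin N) (Fin N) A) (j : ℕ) : Op N A 1 :=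
  qtrs (Dmat Ψ) 1 j
    (chain (1 + j) (R.map (algebraMap K A)) 0 j *
      MbarSeg (1 + j) (F.map (algebraMap K A)) ((F⁻¹).map (algebraMap K A)) M 0 (j + 1))

/-- The `(j+1)`-st wedge power of `M`,
`M^{∧(j+1)} = Tr_F(2,…,j+1)(A^{(j+1)} M_{\overline{1}}⋯M_{\overline{j+1}})`. -/
def MwedgeF {K : Type*} [Field K] {A : Type*} [Ring A] [Algebra K A] {N : ℕ}
    (q : K) (R F Ψ : M2 N K) (M : Matrix (Fin N) (Fin N) A) (j : ℕ) : Op N A 1 :=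
  qtrs (Dmat Ψ) 1 j
    ((qasym q R (1 + j) 0 (j + 1)).map (algebraMap K A) *
      MbarSeg (1 + j) (F.map (algebraMap K A)) ((F⁻¹).map (algebraMap K A)) M 0 (j + 1))

/-- The `(j+1)`-st symmetric power of `M`,
`M^{S(j+1)} = Tr_F(2,…,j+1)(S^{(j+1)} M_{\overline{1}}⋯M_{\overline{j+1}})`. -/
def MsymF {K : Type*} [Field K] {A : Type*} [Ring A] [Algebra K A] {N : ℕ}
    (q : K) (R F Ψ : M2 N K) (M : Matrix (Fin N) (Fin N) A) (j : ℕ) : Op N A 1 :=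
  qtrs (Dmat Ψ) 1 j
    ((qsym q R (1 + j) 0 (j + 1)).map (algebraMap K A) *
      MbarSeg (1 + j) (F.map (algebraMap K A)) ((F⁻¹).map (algebraMap K A)) M 0 (j + 1))

/-- `M^{\overline{0}} := q^{-n} n_q Tr_{(2,…,n)}(A^{(n)}) D^{-1}`, with `n = n0 + 1`
(an ordinary, non-quantum, trace over the factors `2,…,n`). -/
def MzeroF {K : Type*} [Field K] {N : ℕ} (q : K) (R Ψ : M2 N K) (n0 : ℕ) :
    Op N K 1 :=
  (q⁻¹ ^ (n0 + 1) * qInt q (n0 + 1)) •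
    (ptrs 1 n0 (qasym q R (1 + n0) 0 (n0 + 1)) * site1 1 0 ((Dmat Ψ)⁻¹))

/-- The generators of the characteristic subalgebra: all elements
`α(Y^{(k)}) = Tr_F(1,…,k)(Y^{(k)} M_{\overline{1}}⋯M_{\overline{k}})`, `k ≥ 1`. -/
def charSet {K : Type*} [Field K] {A : Type*} [Ring A] [Algebra K A] {N : ℕ}
    (R F Ψ : M2 N K) (M : Matrix (Fin N) (Fin N) A) : Set A :=
  { x : A | ∃ (v : ℕ) (Y : FreeAlgebra K (Fin v)),
      x = qtrAll (Dmat Ψ)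
        (evalY (R.map (algebraMap K A)) 0 Y *
          MbarSeg (v + 1) (F.map (algebraMap K A)) ((F⁻¹).map (algebraMap K A)) M 0 (v + 1)) }

end

section HeckeAlgebra

variable {K B : Type*} [Field K] [Ring B] [Algebra K B]

/-- The `q`-antisymmetrizer on `k` strands written in abstract Hecke generators `g 0, g 1, …`. -/
def hasym (q : K) (g : ℕ → B) : ℕ → B
  | 0 => 1
  | 1 => 1
  | k + 2 =>
      (qInt q (k + 2))⁻¹ •
        (hasym q g (k + 1) * (q ^ (k + 1) • (1 : B) - qInt q (k + 1) • g k) *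
          hasym q g (k + 1))

/-- The first `n` elements of the sequence `g` satisfy the Hecke algebra relations. -/
structure HeckeRel (q : K) (g : ℕ → B) (n : ℕ) : Prop where
  quad : ∀ i, i < n → g i * g i = 1 + (q - q⁻¹) • g i
  braid : ∀ i, i + 1 < n → g i * g (i + 1) * g i = g (i + 1) * g i * g (i + 1)
  comm : ∀ i j, i + 1 < j → j < n → Commute (g i) (g j)

/-- Any relation compatible with the algebra operations passes to the antisymmetrizers. -/
theorem hasym_rel {B' : Type*} [Ring B'] [Algebra K B'] (q : K) (P : B → B' → Prop)
    (hone : P 1 1) (hmul : ∀ x y x' y', P x x' → P y y' → P (x * y) (x' * y'))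
    (hsub : ∀ x y x' y', P x x' → P y y' → P (x - y) (x' - y'))
    (hsmul : ∀ (c : K) x x', P x x' → P (c • x) (c • x'))
    (g : ℕ → B) (g' : ℕ → B') :
    ∀ k, (∀ i, i + 1 < k → P (g i) (g' i)) → P (hasym q g k) (hasym q g' k)
  | 0, _ => hone
  | 1, _ => hone
  | k + 2, h => by
      have ih := hasym_rel q P hone hmul hsub hsmul g g' (k + 1) fun i hi => h i (by omega)
      exact hsmul _ _ _ (hmul _ _ _ _ (hmul _ _ _ _ ih
        (hsub _ _ _ _ (hsmul _ _ _ hone) (hsmul _ _ _ (h k (by omega))))) ih)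

theorem map_hasym {B' : Type*} [Ring B'] [Algebra K B'] (q : K) (φ : B →ₐ[K] B') (g : ℕ → B)
    (k : ℕ) : φ (hasym q g k) = hasym q (fun i => φ (g i)) k :=
  hasym_rel q (fun x y => φ x = y) (map_one φ)
    (fun _ _ _ _ h h' => by rw [map_mul, h, h']) (fun _ _ _ _ h h' => by rw [map_sub, h, h'])
    (fun _ _ _ h => by rw [map_smul, h]) g _ k fun _ _ => rfl

theorem hasym_semiconj (q : K) (c : B) (g g' : ℕ → B) (k : ℕ)
    (h : ∀ i, i + 1 < k → SemiconjBy c (g i) (g' i)) :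
    SemiconjBy c (hasym q g k) (hasym q g' k) :=
  hasym_rel q (SemiconjBy c) (SemiconjBy.one_right c) (fun _ _ _ _ h h' => h.mul_right h')
    (fun _ _ _ _ h h' => h.sub_right h')
    (fun r x x' h => by
      change c * (r • x) = (r • x') * c
      rw [mul_smul_comm, smul_mul_assoc, h.eq]) g g' k h

theorem hasym_commute (q : K) (c : B) (g : ℕ → B) (k : ℕ)
    (h : ∀ i, i + 1 < k → Commute c (g i)) : Commute c (hasym q g k) :=
  hasym_semiconj q c g g k h

theorem hasym_op (q : K) (g : ℕ → B) :
    ∀ k, hasym q (fun i => MulOpposite.op (g i)) k = MulOpposite.op (hasym q g k)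
  | 0 => rfl
  | 1 => rfl
  | k + 2 => by
      simp only [hasym, hasym_op q g (k + 1), MulOpposite.op_smul, MulOpposite.op_mul,
        MulOpposite.op_sub, MulOpposite.op_one, mul_assoc]

theorem HeckeRel.op {q : K} {g : ℕ → B} {n : ℕ} (h : HeckeRel q g n) :
    HeckeRel q (fun i => MulOpposite.op (g i)) n where
  quad i hi := by
    rw [← MulOpposite.op_mul, h.quad i hi]; rfl
  braid i hi := by
    simp only [← MulOpposite.op_mul, ← mul_assoc, h.braid i hi]
  comm i j hij hj := by
    change _ * _ = _ * _
    rw [← MulOpposite.op_mul, ← MulOpposite.op_mul, (h.comm i j hij hj).eq]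

theorem HeckeRel.shift {q : K} {g : ℕ → B} {n : ℕ} (h : HeckeRel q g (n + 1)) :
    HeckeRel q (fun i => g (i + 1)) n where
  quad i hi := h.quad _ (by omega)
  braid i hi := h.braid _ (by omega)
  comm i j hij hj := h.comm _ _ (by omega) (by omega)

variable {q : K}

theorem qInt_one (hq : q - q⁻¹ ≠ 0) : qInt q 1 = 1 := by
  simp [qInt, hq]

theorem qInt_succ (hq : q - q⁻¹ ≠ 0) (k : ℕ) :
    qInt q (k + 1) = q ^ k + q⁻¹ * qInt q k := by
  unfold qInt
  rw [div_eq_iff hq, add_mul, mul_assoc, div_mul_cancel₀ _ hq]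
  ring

/-- The absorption computation behind the induction step for antisymmetrizers. -/
theorem absorb_step (hq0 : q ≠ 0) (hq : q - q⁻¹ ≠ 0) (k : ℕ) (hk : qInt q (k + 1) ≠ 0)
    {g h a' a : B} (hc : Commute a' g) (hb : g * h * g = h * g * h)
    (hg : g * g = 1 + (q - q⁻¹) • g)
    (ha : qInt q (k + 1) • a = a' * (q ^ k • (1 : B) - qInt q k • h) * a')
    (haa : a' * a = a) (hha : h * a = (-q⁻¹) • a) :
    g * (a * (q ^ (k + 1) • (1 : B) - qInt q (k + 1) • g) * a) =
      (-q⁻¹) • (a * (q ^ (k + 1) • (1 : B) - qInt q (k + 1) • g) * a) := by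
  have key : qInt q (k + 1) •
      ((g + q⁻¹ • 1) * (a * (q ^ (k + 1) • (1 : B) - qInt q (k + 1) • g) * a)) = 0 := by
    set s : B := g + q⁻¹ • 1 with hs
    set x : B := q ^ (k + 1) • (1 : B) - qInt q (k + 1) • g with hx
    clear_value s x
    have hsc : Commute a' s := hs ▸ hc.add_right ((Commute.one_right a').smul_right _)
    have hxc : Commute a' x :=
      hx ▸ ((Commute.one_right a').smul_right _).sub_right (hc.smul_right _)
    have hsx : s * x = (-qInt q k) • s := by
      have e : s * g = q • s := by
        simp only [hs, add_mul, hg, smul_mul_assoc, one_mul, smul_add, smul_smul,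
          mul_inv_cancel₀ hq0, one_smul, sub_smul]
        abel
      rw [hx, mul_sub, mul_smul_comm, mul_smul_comm, e, mul_one, smul_smul, ← sub_smul,
        qInt_succ hq]
      congr 1
      field_simp
      ring
    have hgha : s * h * g * a = 0 := by
      have e1 : s * h * g = h * g * (h + q⁻¹ • 1) := by
        simp only [hs, add_mul, mul_add, hb, smul_mul_assoc, one_mul, mul_smul_comm, mul_one]
      rw [e1, mul_assoc, add_mul, hha]
      simp
    have hsha : s * h * x * a = (-q ^ k) • (s * a) := by
      rw [hx, mul_sub, sub_mul, mul_smul_comm, mul_smul_comm, mul_one, smul_mul_assoc,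
        smul_mul_assoc, hgha, smul_zero, sub_zero, mul_assoc, hha, mul_smul_comm, smul_smul]
      congr 1
      rw [mul_neg, pow_succ, mul_assoc, mul_inv_cancel₀ hq0, mul_one]
    calc qInt q (k + 1) • (s * (a * x * a))
        = s * ((qInt q (k + 1) • a) * x * a) := by
          simp only [smul_mul_assoc, mul_smul_comm]
      _ = a' * (s * (q ^ k • (1 : B) - qInt q k • h) * x * (a' * a)) := by
          rw [ha]
          simp only [mul_assoc]
          rw [← mul_assoc s, ← hsc.eq, mul_assoc]
          rw [← mul_assoc a' x, hxc.eq, mul_assoc]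
      _ = a' * (q ^ k • (s * x * a) - qInt q k • (s * h * x * a)) := by
          rw [haa, mul_sub s, sub_mul, sub_mul, mul_smul_comm, mul_smul_comm, mul_one,
            smul_mul_assoc, smul_mul_assoc, smul_mul_assoc, smul_mul_assoc]
      _ = 0 := by
          rw [hsha, hsx, smul_mul_assoc, smul_smul, smul_smul, ← sub_smul]
          rw [show q ^ k * -qInt q k - qInt q k * -q ^ k = 0 by ring, zero_smul, mul_zero]
  have h2 := (smul_eq_zero.mp key).resolve_left hk
  rw [add_mul, smul_mul_assoc, one_mul] at h2
  rw [neg_smul]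
  exact eq_neg_of_add_eq_zero_left h2

theorem hasym_mul_of_absorb (hq0 : q ≠ 0) (hq : q - q⁻¹ ≠ 0)
    (hqn : ∀ n : ℕ, 1 ≤ n → qInt q n ≠ 0) (g : ℕ → B) (x : B) :
    ∀ k, (∀ i, i + 1 < k → g i * x = (-q⁻¹) • x) → hasym q g k * x = x
  | 0, _ => one_mul x
  | 1, _ => one_mul x
  | k + 2, h => by
      have ih := hasym_mul_of_absorb hq0 hq hqn g x (k + 1) fun i hi => h i (by omega)
      rw [hasym, smul_mul_assoc, mul_assoc, ih, mul_assoc, sub_mul, smul_mul_assoc,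
        smul_mul_assoc, h k (by omega), one_mul, smul_smul, ← sub_smul, mul_smul_comm, ih,
        smul_smul]
      rw [show qInt q (k + 2) = _ from qInt_succ hq (k + 1), mul_neg, sub_neg_eq_add,
        mul_comm (qInt q (k + 1)), ← qInt_succ hq (k + 1),
        inv_mul_cancel₀ (hqn _ (by omega)), one_smul]

theorem gen_mul_hasym (hq0 : q ≠ 0) (hq : q - q⁻¹ ≠ 0)
    (hqn : ∀ n : ℕ, 1 ≤ n → qInt q n ≠ 0) {g : ℕ → B} {n : ℕ} (hg : HeckeRel q g n) :
    ∀ k, k ≤ n + 1 → ∀ i, i + 1 < k → g i * hasym q g k = (-q⁻¹) • hasym q g k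
  | 0, _, _, hi => by omega
  | 1, _, _, hi => by omega
  | 2, hk, i, hi => by
      obtain rfl : i = 0 := by omega
      simp only [hasym, one_mul, mul_one, zero_add, pow_one, qInt_one hq, one_smul,
        mul_smul_comm]
      rw [smul_comm]
      congr 1
      rw [mul_sub, mul_smul_comm, mul_one, hg.quad 0 (by omega), smul_sub, smul_smul, sub_smul]
      simp [hq0]
      abel
  | k + 3, hk, i, hi => by
      have ih := gen_mul_hasym hq0 hq hqn hg (k + 2) (by omega)
      rcases Nat.lt_or_ge i (k + 1) with h | h
      · rw [hasym, mul_smul_comm, ← mul_assoc, ← mul_assoc, ih i (by omega), smul_mul_assoc,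
          smul_mul_assoc, smul_comm]
      · obtain rfl : i = k + 1 := by omega
        rw [hasym, mul_smul_comm, smul_comm]
        congr 1
        have h0 := hqn (k + 2) (by omega)
        refine absorb_step hq0 hq (k + 1) h0 (h := g k) (a' := hasym q g (k + 1)) ?_
          (hg.braid k (by omega)).symm (hg.quad _ (by omega)) ?_ ?_ (ih k (by omega))
        · exact (hasym_commute q _ g _ fun j hj => (hg.comm j (k + 1) (by omega) (by omega)).symm).symm
        · rw [hasym, smul_smul, mul_inv_cancel₀ h0, one_smul]
        · exact hasym_mul_of_absorb hq0 hq hqn g _ _ fun j hj => ih j (by omega)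

theorem mul_hasym_of_absorb (hq0 : q ≠ 0) (hq : q - q⁻¹ ≠ 0)
    (hqn : ∀ n : ℕ, 1 ≤ n → qInt q n ≠ 0) (g : ℕ → B) (x : B) (k : ℕ)
    (h : ∀ i, i + 1 < k → x * g i = (-q⁻¹) • x) : x * hasym q g k = x := by
  have := hasym_mul_of_absorb hq0 hq hqn (fun i => MulOpposite.op (g i)) (MulOpposite.op x) k
    fun i hi => by rw [← MulOpposite.op_mul, h i hi, MulOpposite.op_smul]
  rw [hasym_op, ← MulOpposite.op_mul] at this
  exact MulOpposite.op_injective this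

theorem hasym_mul_gen (hq0 : q ≠ 0) (hq : q - q⁻¹ ≠ 0)
    (hqn : ∀ n : ℕ, 1 ≤ n → qInt q n ≠ 0) {g : ℕ → B} {n : ℕ} (hg : HeckeRel q g n)
    (k : ℕ) (hk : k ≤ n + 1) (i : ℕ) (hi : i + 1 < k) :
    hasym q g k * g i = (-q⁻¹) • hasym q g k := by
  have := gen_mul_hasym hq0 hq hqn hg.op k hk i hi
  rw [hasym_op, ← MulOpposite.op_mul, ← MulOpposite.op_smul] at this
  exact MulOpposite.op_injective this

theorem hasym_idem (hq0 : q ≠ 0) (hq : q - q⁻¹ ≠ 0)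
    (hqn : ∀ n : ℕ, 1 ≤ n → qInt q n ≠ 0) {g : ℕ → B} {n : ℕ} (hg : HeckeRel q g n)
    (k : ℕ) (hk : k ≤ n + 1) : hasym q g k * hasym q g k = hasym q g k :=
  hasym_mul_of_absorb hq0 hq hqn g _ k (gen_mul_hasym hq0 hq hqn hg k hk)

/-- The antisymmetrizer can also be built by adding strands on the left. -/
theorem hasym_mirror (hq0 : q ≠ 0) (hq : q - q⁻¹ ≠ 0)
    (hqn : ∀ n : ℕ, 1 ≤ n → qInt q n ≠ 0) :
    ∀ (k : ℕ) {g : ℕ → B}, HeckeRel q g (k + 1) →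
    hasym q g (k + 2) = (qInt q (k + 2))⁻¹ •
      (hasym q (fun i => g (i + 1)) (k + 1) *
        (q ^ (k + 1) • (1 : B) - qInt q (k + 1) • g 0) *
        hasym q (fun i => g (i + 1)) (k + 1))
  | 0, g, hg => rfl
  | k + 1, g, hg => by
      set a := hasym q g (k + 3) with ha
      set a₁ := hasym q (fun i => g (i + 1)) (k + 2) with ha₁
      set b := (qInt q (k + 3))⁻¹ •
        (a₁ * (q ^ (k + 2) • (1 : B) - qInt q (k + 2) • g 0) * a₁) with hb
      change a = b
      have h₁ := hg.shift
      have hab : a * b = b := by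
        refine hasym_mul_of_absorb hq0 hq hqn g _ _ fun i hi => ?_
        rw [hb, mul_smul_comm, smul_comm (-q⁻¹)]
        congr 1
        rcases i with _ | i
        · have h0 := hqn (k + 2) (by omega)
          have hm := hasym_mirror hq0 hq hqn k h₁
          refine absorb_step hq0 hq (k + 1) h0 (h := g 1)
            (a' := hasym q (fun i => g (i + 1 + 1)) (k + 1)) ?_
            (hg.braid 0 (by omega)) (hg.quad _ (by omega)) ?_ ?_
            (gen_mul_hasym hq0 hq hqn h₁ _ (by omega) 0 (by omega))
          · exact (hasym_commute q _ _ _ fun j hj =>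
              hg.comm 0 (j + 1 + 1) (by omega) (by omega)).symm
          · rw [ha₁, hm, smul_smul, mul_inv_cancel₀ h0, one_smul]
          · exact hasym_mul_of_absorb hq0 hq hqn _ _ _ fun j hj =>
              gen_mul_hasym hq0 hq hqn h₁ (k + 2) (by omega) (j + 1) (by omega)
        · rw [← mul_assoc, ← mul_assoc,
            gen_mul_hasym hq0 hq hqn h₁ (k + 2) (by omega) i (by omega),
            smul_mul_assoc, smul_mul_assoc]
      have hab' : a * b = a := by
        have e1 : a * a₁ = a :=
          mul_hasym_of_absorb hq0 hq hqn _ a _ fun i hi =>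
            hasym_mul_gen hq0 hq hqn hg (k + 3) (by omega) (i + 1) (by omega)
        rw [hb, mul_smul_comm, ← mul_assoc, ← mul_assoc, e1, mul_sub, mul_smul_comm,
          mul_smul_comm, mul_one, hasym_mul_gen hq0 hq hqn hg (k + 3) (by omega) 0 (by omega),
          smul_smul, ← sub_smul, smul_mul_assoc, e1, smul_smul, mul_neg, sub_neg_eq_add,
          mul_comm (qInt q (k + 2)), ← qInt_succ hq (k + 2),
          inv_mul_cancel₀ (hqn _ (by omega)), one_smul]
      rw [← hab', hab]

end HeckeAlgebra

section Embeddings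

variable {A : Type*} [Ring A] {N : ℕ}

theorem sum_snoc {S : Type*} [AddCommMonoid S] {m : ℕ} (f : (Fin (m + 1) → Fin N) → S) :
    ∑ a, f a = ∑ a : Fin m → Fin N, ∑ c : Fin N, f (Fin.snoc a c) := by
  rw [← (Fin.snocEquiv fun _ : Fin (m + 1) => Fin N).sum_comp, Fintype.sum_prod_type_right]
  rfl

theorem snoc_inj {m : ℕ} {a b : Fin m → Fin N} {c d : Fin N} :
    (Fin.snoc a c : Fin (m + 1) → Fin N) = Fin.snoc b d ↔ a = b ∧ c = d :=
  Fin.snoc_inj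

theorem op_ext {m : ℕ} {X Y : Op N A (m + 1)}
    (h : ∀ (a b : Fin m → Fin N) (c d : Fin N),
      X (Fin.snoc a c) (Fin.snoc b d) = Y (Fin.snoc a c) (Fin.snoc b d)) : X = Y := by
  ext a b
  rw [← Fin.snoc_init_self a, ← Fin.snoc_init_self b]
  exact h _ _ _ _

theorem mul_apply_snoc {m : ℕ} (X Y : Op N A (m + 1)) (a b : Fin (m + 1) → Fin N) :
    (X * Y) a b = ∑ x : Fin m → Fin N, ∑ y : Fin N, X a (Fin.snoc x y) * Y (Fin.snoc x y) b := by
  rw [Matrix.mul_apply, sum_snoc]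

theorem one_apply_snoc {m : ℕ} (a b : Fin m → Fin N) (c d : Fin N) :
    (1 : Op N A (m + 1)) (Fin.snoc a c) (Fin.snoc b d) =
      (1 : Op N A m) a b * if c = d then 1 else 0 := by
  simp only [Matrix.one_apply, snoc_inj]
  by_cases h : a = b <;> simp [h]

/-- The underlying function of `emb`. -/
def embFun {m : ℕ} (X : Op N A m) : Op N A (m + 1) :=
  Matrix.of fun a b => X (Fin.init a) (Fin.init b) * if a (Fin.last m) = b (Fin.last m) then 1 else 0

theorem embFun_snoc {m : ℕ} (X : Op N A m) (a b : Fin m → Fin N) (c d : Fin N) :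
    embFun X (Fin.snoc a c) (Fin.snoc b d) = X a b * if c = d then 1 else 0 := by
  have e : ∀ (a : Fin m → Fin N) (c : Fin N),
      Fin.init (Fin.snoc a c : Fin (m + 1) → Fin N) = a := fun a c =>
    Fin.init_snoc (α := fun _ => Fin N) c a
  have e' : ∀ (a : Fin m → Fin N) (c : Fin N),
      (Fin.snoc a c : Fin (m + 1) → Fin N) (Fin.last m) = c := fun a c =>
    Fin.snoc_last (α := fun _ => Fin N) c a
  rw [embFun, Matrix.of_apply, e, e, e', e']

/-- Tensoring an operator on the right with the identity of one more factor. -/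
def emb {m : ℕ} : Op N A m →+* Op N A (m + 1) where
  toFun := embFun
  map_one' := op_ext fun a b c d => by
    rw [one_apply_snoc, embFun_snoc]
  map_mul' X Y := op_ext fun a b c d => by
    rw [mul_apply_snoc]
    simp only [embFun_snoc, Matrix.mul_apply, mul_ite, mul_one, mul_zero, ite_mul, zero_mul]
    by_cases h : c = d
    · subst h; simp
    · simp [h]
  map_zero' := op_ext fun a b c d => by
    rw [embFun_snoc, Matrix.zero_apply, Matrix.zero_apply, zero_mul]
  map_add' X Y := op_ext fun a b c d => by
    rw [Matrix.add_apply, embFun_snoc, embFun_snoc, embFun_snoc, Matrix.add_apply, add_mul]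

theorem emb_apply_snoc {m : ℕ} (X : Op N A m) (a b : Fin m → Fin N) (c d : Fin N) :
    emb X (Fin.snoc a c) (Fin.snoc b d) = X a b * if c = d then 1 else 0 :=
  embFun_snoc X a b c d

theorem emb_mul_apply {m : ℕ} (X : Op N A m) (Y : Op N A (m + 1)) (a : Fin m → Fin N)
    (c : Fin N) (b : Fin (m + 1) → Fin N) :
    (emb X * Y) (Fin.snoc a c) b = ∑ x, X a x * Y (Fin.snoc x c) b := by
  simp [mul_apply_snoc, emb_apply_snoc]

theorem mul_emb_apply {m : ℕ} (X : Op N A m) (Y : Op N A (m + 1)) (a : Fin m → Fin N)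
    (c : Fin N) (b : Fin (m + 1) → Fin N) :
    (Y * emb X) b (Fin.snoc a c) = ∑ x, Y b (Fin.snoc x c) * X x a := by
  simp [mul_apply_snoc, emb_apply_snoc]

/-- The underlying function of `shift`. -/
def shiftFun {m : ℕ} (X : Op N A m) : Op N A (m + 1) :=
  Matrix.of fun a b => X (Fin.tail a) (Fin.tail b) * if a 0 = b 0 then 1 else 0

/-- Tensoring an operator on the left with the identity of one more factor. -/
def shift {m : ℕ} : Op N A m →+* Op N A (m + 1) where
  toFun := shiftFun
  map_one' := by
    ext a b
    rw [← Fin.cons_self_tail a, ← Fin.cons_self_tail b]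
    simp only [shiftFun, Matrix.of_apply, Matrix.one_apply, Fin.cons_inj,
      Fin.cons_zero]
    by_cases h : a 0 = b 0 <;> simp [h]
  map_mul' X Y := by
    ext a b
    rw [Matrix.mul_apply, ← (Fin.consEquiv fun _ : Fin (m + 1) => Fin N).sum_comp,
      Fintype.sum_prod_type_right]
    simp only [shiftFun, Matrix.of_apply, Matrix.mul_apply, Fin.consEquiv_apply,
      Fin.cons_zero, mul_ite, mul_one, mul_zero, ite_mul, zero_mul]
    rw [Finset.sum_comm' (t' := Finset.univ) (s' := fun _ => Finset.univ) (by simp)]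
    simp only [Fin.consEquiv]
    by_cases h : a 0 = b 0
    · simp [h]
    · simp [h]
  map_zero' := by ext; simp [shiftFun]
  map_add' X Y := by
    ext
    simp only [shiftFun, Matrix.of_apply, Matrix.add_apply, add_mul]

theorem emb_site {m i : ℕ} (h : i + 1 < m) (X : M2 N A) :
    emb (site m i X) = site (m + 1) i X := by
  refine op_ext fun a b c d => ?_
  rw [emb_apply_snoc]
  have h' : i + 1 < m + 1 := by omega
  have e : ∀ (a : Fin m → Fin N) (c : Fin N) (j : ℕ) (hj : j < m) (hj' : j < m + 1),
      (Fin.snoc a c : Fin (m + 1) → Fin N) ⟨j, hj'⟩ = a ⟨j, hj⟩ := fun a c j hj hj' =>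
    Fin.snoc_castSucc (α := fun _ => Fin N) c a ⟨j, hj⟩
  simp only [site, h, h', dif_pos]
  rw [e a c i (by omega), e a c (i + 1) h, e b d i (by omega), e b d (i + 1) h, mul_assoc]
  congr 1
  simp only [Fin.forall_fin_succ', Fin.snoc_castSucc, Fin.snoc_last, Fin.val_castSucc, Fin.val_last]
  have h1 : m ≠ i := by omega
  have h2 : m ≠ i + 1 := by omega
  simp only [ne_eq, h1, h2, not_false_eq_true, forall_const]
  split_ifs <;> simp_all

theorem emb_site1 {m i : ℕ} (h : i < m) (X : Matrix (Fin N) (Fin N) A) :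
    emb (site1 m i X) = site1 (m + 1) i X := by
  refine op_ext fun a b c d => ?_
  rw [emb_apply_snoc]
  have h' : i < m + 1 := by omega
  have e : ∀ (a : Fin m → Fin N) (c : Fin N) (j : ℕ) (hj : j < m) (hj' : j < m + 1),
      (Fin.snoc a c : Fin (m + 1) → Fin N) ⟨j, hj'⟩ = a ⟨j, hj⟩ := fun a c j hj hj' =>
    Fin.snoc_castSucc (α := fun _ => Fin N) c a ⟨j, hj⟩
  simp only [site1, h, h', dif_pos]
  rw [e a c i (by omega), e b d i (by omega), mul_assoc]
  congr 1
  simp only [Fin.forall_fin_succ', Fin.snoc_castSucc, Fin.snoc_last, Fin.val_castSucc, Fin.val_last]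
  have h1 : m ≠ i := by omega
  simp only [ne_eq, h1, not_false_eq_true, forall_const]
  split_ifs <;> simp_all

theorem shift_site {m i : ℕ} (h : i + 1 < m) (X : M2 N A) :
    shift (site m i X) = site (m + 1) (i + 1) X := by
  ext a b
  have h' : i + 1 + 1 < m + 1 := by omega
  change site m i X (Fin.tail a) (Fin.tail b) * _ = _
  simp only [site, h, h', dif_pos, mul_assoc]
  have e : ∀ (a : Fin (m + 1) → Fin N) (j : ℕ) (hj : j < m) (hj' : j + 1 < m + 1),
      Fin.tail a ⟨j, hj⟩ = a ⟨j + 1, hj'⟩ := fun _ _ _ _ => rfl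
  rw [e a i (by omega) (by omega), e a (i + 1) h h', e b i (by omega) (by omega),
    e b (i + 1) h h']
  congr 1
  simp only [Fin.forall_fin_succ, Fin.val_zero, Fin.val_succ, Fin.tail]
  have h1 : 0 ≠ i + 1 := by omega
  have h2 : 0 ≠ i + 1 + 1 := by omega
  simp only [ne_eq, h1, h2, not_false_eq_true, forall_const, Nat.add_right_cancel_iff]
  by_cases h0 : a 0 = b 0
  · simp only [h0, if_true, true_and, mul_one]
    by_cases h3 : ∀ j : Fin m, ¬(j : ℕ) = i → ¬(j : ℕ) = i + 1 → a j.succ = b j.succ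
    · exact (if_pos h3).trans (if_pos h3).symm
    · exact (if_neg h3).trans (if_neg h3).symm
  · simp [h0]

theorem site_last_apply {m : ℕ} (X : M2 N A) (a b : Fin m → Fin N) (c d e f : Fin N) :
    site (m + 2) m X (Fin.snoc (Fin.snoc a c : Fin (m + 1) → Fin N) d)
      (Fin.snoc (Fin.snoc b e : Fin (m + 1) → Fin N) f) =
      X (c, d) (e, f) * if a = b then 1 else 0 := by
  have h : m + 1 < m + 2 := by omega
  have e1 : ∀ (a : Fin (m + 1) → Fin N) (c : Fin N) (hj : m + 1 < m + 2),
      (Fin.snoc a c : Fin (m + 2) → Fin N) ⟨m + 1, hj⟩ = c := fun a c hj =>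
    Fin.snoc_last (α := fun _ => Fin N) c a
  have e2 : ∀ (a : Fin m → Fin N) (c d : Fin N) (hj : m < m + 2),
      (Fin.snoc (Fin.snoc a c : Fin (m + 1) → Fin N) d : Fin (m + 2) → Fin N) ⟨m, hj⟩ = c :=
    fun a c d hj => (Fin.snoc_castSucc (α := fun _ => Fin N) d _ (Fin.last m)).trans
      (Fin.snoc_last (α := fun _ => Fin N) c a)
  simp only [site, h, dif_pos]
  rw [e1, e2, e1, e2]
  congr 1
  simp only [Fin.forall_fin_succ', funext_iff, Fin.snoc_castSucc, Fin.snoc_last, Fin.val_castSucc, Fin.val_last]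
  have key : ∀ p r : Prop, (p ↔ r) → ∀ [Decidable p] [Decidable r],
      (if p then (1 : A) else 0) = if r then 1 else 0 := fun p r h _ _ => if_congr h rfl rfl
  exact key _ _ ⟨fun h j => h.1.1 j (by omega) (by omega), fun h =>
    ⟨⟨fun j _ _ => h j, by simp⟩, by simp⟩⟩

theorem site_last_mul_apply {m : ℕ} (X : M2 N A) (Y : Op N A (m + 2)) (a : Fin m → Fin N)
    (c d : Fin N) (b : Fin (m + 2) → Fin N) :
    (site (m + 2) m X * Y) (Fin.snoc (Fin.snoc a c : Fin (m + 1) → Fin N) d) b =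
      ∑ x, ∑ y, X (c, d) (x, y) * Y (Fin.snoc (Fin.snoc a x : Fin (m + 1) → Fin N) y) b := by
  rw [mul_apply_snoc, sum_snoc]
  simp only [site_last_apply, mul_ite, mul_one, mul_zero, ite_mul, zero_mul]
  rw [Finset.sum_eq_single a]
  · simp
  · intro b _ hb
    simp [hb.symm]
  · simp

theorem mul_site_last_apply {m : ℕ} (X : M2 N A) (Y : Op N A (m + 2)) (a : Fin m → Fin N)
    (c d : Fin N) (b : Fin (m + 2) → Fin N) :
    (Y * site (m + 2) m X) b (Fin.snoc (Fin.snoc a c : Fin (m + 1) → Fin N) d) =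
      ∑ x, ∑ y, Y b (Fin.snoc (Fin.snoc a x : Fin (m + 1) → Fin N) y) * X (x, y) (c, d) := by
  rw [mul_apply_snoc, sum_snoc]
  simp only [site_last_apply, mul_ite, mul_one, mul_zero]
  rw [Finset.sum_eq_single a]
  · simp
  · intro b _ hb
    simp [hb]
  · simp

/-- A property of the last pair of factors propagates to any pair of neighbours. -/
theorem site_induction {P : ℕ → ℕ → Prop} (hlast : ∀ m, P (m + 2) m)
    (hemb : ∀ m i, i + 1 < m → P m i → P (m + 1) i) {m i : ℕ} (h : i + 1 < m) : P m i := by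
  obtain ⟨t, rfl⟩ := Nat.exists_eq_add_of_lt h
  induction t with
  | zero => exact hlast i
  | succ t ih => exact hemb _ _ (by omega) (ih (by omega))

theorem site_mul {m i : ℕ} (h : i + 1 < m) (X Y : M2 N A) :
    site m i (X * Y) = site m i X * site m i Y := by
  refine site_induction (P := fun m i => site m i (X * Y) = site m i X * site m i Y)
    (fun m => ?_) (fun m i hi ih => ?_) h
  · refine op_ext fun a b c d => ?_
    rw [← Fin.snoc_init_self a, ← Fin.snoc_init_self b, site_last_mul_apply, site_last_apply]
    simp only [site_last_apply, Matrix.mul_apply, Fintype.sum_prod_type, Finset.sum_mul,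
      mul_assoc]
  · rw [← emb_site hi, ← emb_site hi, ← emb_site hi, ih, map_mul]

theorem site_one (m i : ℕ) : site m i (1 : M2 N A) = 1 := by
  by_cases h : i + 1 < m
  · refine site_induction (P := fun m i => site m i (1 : M2 N A) = 1)
      (fun m => ?_) (fun m i hi ih => ?_) h
    · refine op_ext fun a b c d => ?_
      rw [← Fin.snoc_init_self a, ← Fin.snoc_init_self b, site_last_apply, one_apply_snoc,
        one_apply_snoc, Matrix.one_apply, Matrix.one_apply]
      simp only [Prod.mk.injEq]
      split_ifs <;> simp_all
    · rw [← emb_site hi, ih, map_one]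
  · ext a b
    simp [site, h, Matrix.one_apply]

theorem site_add {m i : ℕ} (h : i + 1 < m) (X Y : M2 N A) :
    site m i (X + Y) = site m i X + site m i Y := by
  ext a b
  simp only [site, h, dif_pos, Matrix.add_apply, add_mul]

theorem site_smul {K : Type*} [Field K] [Algebra K A] {m i : ℕ} (h : i + 1 < m) (r : K)
    (X : M2 N A) : site m i (r • X) = r • site m i X := by
  ext a b
  simp only [site, h, dif_pos, Matrix.smul_apply, smul_mul_assoc]

theorem emb_smul {K : Type*} [Field K] [Algebra K A] {m : ℕ} (r : K)
    (X : Op N A m) : emb (r • X) = r • emb X :=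
  op_ext fun a b c d => by
    rw [Matrix.smul_apply, emb_apply_snoc, emb_apply_snoc, Matrix.smul_apply, smul_mul_assoc]

/-- Three-site relations can be transported to any three consecutive sites. -/
theorem exists_hom_three {m i : ℕ} (h : i + 2 < m) :
    ∃ φ : Op N A 3 →+* Op N A m, ∀ X : M2 N A,
      φ (site 3 0 X) = site m i X ∧ φ (site 3 1 X) = site m (i + 1) X := by
  induction i generalizing m with
  | zero =>
    obtain ⟨t, rfl⟩ := Nat.exists_eq_add_of_lt h
    induction t with
    | zero => exact ⟨RingHom.id _, fun X => ⟨rfl, rfl⟩⟩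
    | succ t ih =>
      obtain ⟨φ, hφ⟩ := ih (by omega)
      refine ⟨emb.comp φ, fun X => ?_⟩
      simp only [RingHom.comp_apply, (hφ X).1, (hφ X).2]
      exact ⟨emb_site (by omega) X, emb_site (by omega) X⟩
  | succ i ih =>
    obtain ⟨m, rfl⟩ : ∃ m', m = m' + 1 := ⟨m - 1, by omega⟩
    obtain ⟨φ, hφ⟩ := ih (m := m) (by omega)
    refine ⟨shift.comp φ, fun X => ?_⟩
    simp only [RingHom.comp_apply, (hφ X).1, (hφ X).2]
    exact ⟨shift_site (by omega) X, shift_site (by omega) X⟩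

end Embeddings

section Scalars

variable {K : Type*} [Field K] {A : Type*} [Ring A] [Algebra K A] {N : ℕ}

theorem site_mul' (m i : ℕ) (X Y : M2 N A) :
    site m i (X * Y) = site m i X * site m i Y := by
  by_cases h : i + 1 < m
  · exact site_mul h X Y
  · have e : ∀ Z : M2 N A, site m i Z = 1 := fun Z => by
      ext a b
      simp [site, h, Matrix.one_apply]
    rw [e, e, e, mul_one]

variable (A) in
/-- Operators with entries in the ground field, seen as operators with entries in `A`. -/
def sc {m : ℕ} : Op N K m →ₐ[K] Op N A m := (Algebra.ofId K A).mapMatrix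

theorem sc_apply {m : ℕ} (X : Op N K m) (a b : Fin m → Fin N) :
    sc A X a b = algebraMap K A (X a b) := rfl

theorem map_eq_sc {m : ℕ} (X : Op N K m) : X.map (algebraMap K A) = sc A X := rfl

theorem site_map (m i : ℕ) (X : M2 N K) :
    site m i (X.map (algebraMap K A)) = sc A (site m i X) := by
  ext a b
  rw [sc_apply]
  unfold site
  split_ifs <;> simp

theorem chain_map (m : ℕ) (X : M2 N K) (i : ℕ) :
    ∀ l, chain m (X.map (algebraMap K A)) i l = sc A (chain m X i l)
  | 0 => (map_one _).symm
  | l + 1 => by rw [chain, chain, map_mul, chain_map m X i l, site_map]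

theorem emb_sc {m : ℕ} (X : Op N K m) : emb (sc A X) = sc A (emb X) :=
  op_ext fun a b c d => by
    rw [sc_apply, emb_apply_snoc, emb_apply_snoc, sc_apply]
    split_ifs <;> simp

theorem qasym_eq_hasym (q : K) (R : M2 N K) (m p : ℕ) :
    ∀ k, qasym q R m p k = hasym q (fun i => site m (p + i) R) k
  | 0 => rfl
  | 1 => rfl
  | k + 2 => by simp only [qasym, hasym, qasym_eq_hasym q R m p (k + 1)]

theorem commute_last {m : ℕ} (X : Op N A m) (Y : M2 N K) :
    Commute (sc A (site (m + 2) m Y)) (emb (emb X)) := by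
  refine op_ext fun a b c d => ?_
  rw [← Fin.snoc_init_self a, ← Fin.snoc_init_self b, ← site_map, site_last_mul_apply,
    mul_site_last_apply]
  simp only [emb_apply_snoc, Matrix.map_apply]
  simp [Algebra.commutes]

theorem commute_site {m i j : ℕ} (hij : i + 1 < j) (hj : j + 1 < m) (X Y : M2 N K) :
    Commute (site m i X) (site m j Y) := by
  have := site_induction (P := fun m j => ∀ i, i + 1 < j → Commute (site m i X) (site m j Y))
    (fun m i hi => ?_) (fun m j hj ih i hi => ?_) hj
  · exact this i hij
  · have := (commute_last (A := K) (site m i X) Y).symm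
    rw [emb_site (by omega), emb_site (by omega)] at this
    exact this
  · have := (ih i hi).map (emb (N := N) (A := K))
    rwa [emb_site (by omega), emb_site (by omega)] at this

theorem commute_sc_site {m i j : ℕ} (hij : i + 1 < j) (hj : j + 1 < m) (X Y : M2 N K) :
    Commute (sc A (site m i X)) (sc A (site m j Y)) :=
  (commute_site hij hj X Y).map (sc A)

/-- A two-site operator placed at the given sites, as a multiplicative map. -/
def siteHom (m i : ℕ) : M2 N K →* Op N A m where
  toFun X := sc A (site m i X)
  map_one' := by rw [site_one, map_one]
  map_mul' X Y := by rw [site_mul', map_mul]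

/-- The Yang--Baxter equation holds at any neighbouring sites. -/
theorem three_transport {m i : ℕ} (h : i + 2 < m) {X Y Z X' Y' Z' : M2 N K}
    {s t u s' t' u' : Fin 2}
    (hX : site 3 s X * site 3 t Y * site 3 u Z = site 3 s' X' * site 3 t' Y' * site 3 u' Z') :
    sc A (site m (i + s) X) * sc A (site m (i + t) Y) * sc A (site m (i + u) Z) =
      sc A (site m (i + s') X') * sc A (site m (i + t') Y') * sc A (site m (i + u') Z') := by
  obtain ⟨φ, hφ⟩ := exists_hom_three (A := K) (N := N) h
  have e : ∀ (s : Fin 2) (X : M2 N K), φ (site 3 s X) = site m (i + s) X := by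
    intro s X
    fin_cases s
    · exact (hφ X).1
    · exact (hφ X).2
  have := congrArg φ hX
  simp only [map_mul, e] at this
  simp only [← map_mul, this]

end Scalars

noncomputable section Copies

variable {K : Type*} [Field K] {A : Type*} [Ring A] [Algebra K A] {N : ℕ}

/-- The copies of `M`, with the scalar matrix `F` as input. -/
abbrev Mb (F : M2 N K) (M : Matrix (Fin N) (Fin N) A) (m k : ℕ) : Op N A m :=
  Mbar m (F.map (algebraMap K A)) ((F⁻¹).map (algebraMap K A)) M k

variable (F : M2 N K) (M : Matrix (Fin N) (Fin N) A)

theorem Mb_succ (m k : ℕ) :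
    Mb F M m (k + 1) = sc A (site m k F) * Mb F M m k * sc A (site m k F⁻¹) := by
  rw [Mb, Mbar, site_map, site_map]

theorem emb_Mb {m : ℕ} : ∀ {k : ℕ}, k < m → emb (Mb F M m k) = Mb F M (m + 1) k
  | 0, h => emb_site1 h M
  | k + 1, h => by
      rw [Mb_succ, Mb_succ, map_mul, map_mul, emb_Mb (by omega), emb_sc, emb_sc,
        emb_site h, emb_site h]

theorem commute_Mb_right {m i j : ℕ} (hij : i < j) (hj : j + 1 < m) (X : M2 N K) :
    Commute (sc A (site m j X)) (Mb F M m i) := by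
  refine site_induction (P := fun m j => i < j → Commute (sc A (site m j X)) (Mb F M m i))
    (fun m hi => ?_) (fun m j hj ih hi => ?_) hj hij
  · rw [← emb_Mb F M (by omega), ← emb_Mb F M (by omega)]
    exact commute_last _ X
  · have := (ih hi).map (emb (N := N) (A := A))
    rwa [emb_sc, emb_site hj, emb_Mb F M (by omega)] at this

variable {F}

theorem inv_mul_of_isUnit (hF : IsUnit F) : F⁻¹ * F = 1 :=
  Matrix.nonsing_inv_mul F ((Matrix.isUnit_iff_isUnit_det F).1 hF)

theorem mul_inv_of_isUnit (hF : IsUnit F) : F * F⁻¹ = 1 :=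
  Matrix.mul_nonsing_inv F ((Matrix.isUnit_iff_isUnit_det F).1 hF)

/-- The invertible operator `F` at given sites. -/
def siteUnit (A : Type*) [Ring A] [Algebra K A] (hF : IsUnit F) (m i : ℕ) : (Op N A m)ˣ :=
  Units.map (siteHom m i) ⟨F, F⁻¹, mul_inv_of_isUnit hF, inv_mul_of_isUnit hF⟩

theorem siteUnit_val (hF : IsUnit F) (m i : ℕ) :
    ((siteUnit A hF m i : (Op N A m)ˣ) : Op N A m) = sc A (site m i F) := rfl

theorem siteUnit_inv (hF : IsUnit F) (m i : ℕ) :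
    (((siteUnit A hF m i)⁻¹ : (Op N A m)ˣ) : Op N A m) = sc A (site m i F⁻¹) := rfl

theorem commute_Mb_left (hF : IsUnit F) {X : M2 N K}
    (hX : site 3 0 X * site 3 1 F * site 3 0 F = site 3 1 F * site 3 0 F * site 3 1 X)
    {m j i : ℕ} (hij : j + 2 ≤ i) (hi : i < m) : Commute (sc A (site m j X)) (Mb F M m i) := by
  induction i, hij using Nat.le_induction with
  | base =>
    have key := three_transport (A := A) (m := m) (i := j) (s := 0) (t := 1) (u := 0) (s' := 1)
      (t' := 0) (u' := 1) (by omega) hX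
    have c1 : SemiconjBy
        ((siteUnit A hF m (j + 1) * siteUnit A hF m j : (Op N A m)ˣ) : Op N A m)
        (sc A (site m (j + 1) X)) (sc A (site m j X)) := by
      have : _ = _ := key.symm
      simp only [Fin.isValue, Fin.val_one, Fin.val_zero, add_zero] at this
      rw [SemiconjBy, Units.val_mul, siteUnit_val, siteUnit_val, this, mul_assoc]
    have c2 := c1.units_inv_symm_left
    have c3 : Commute (sc A (site m (j + 1) X)) (Mb F M m j) :=
      commute_Mb_right F M (by omega) (by omega) X
    have e : Mb F M m (j + 2) =
        ((siteUnit A hF m (j + 1) * siteUnit A hF m j : (Op N A m)ˣ) : Op N A m) * Mb F M m j *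
          ((siteUnit A hF m (j + 1) * siteUnit A hF m j : (Op N A m)ˣ)⁻¹ : (Op N A m)ˣ) := by
      rw [Mb_succ, Mb_succ, mul_inv_rev, Units.val_mul, Units.val_mul, siteUnit_val,
        siteUnit_val, siteUnit_inv, siteUnit_inv]
      simp only [mul_assoc]
    rw [e]
    exact (((SemiconjBy.mul_left c1 c3.symm).mul_left c2)).symm
  | succ i hij ih =>
    rw [Mb_succ]
    have h1 : ∀ Y : M2 N K, Commute (sc A (site m j X)) (sc A (site m i Y)) := fun Y =>
      commute_sc_site (by omega) (by omega) X Y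
    exact ((h1 F).mul_right (ih (by omega))).mul_right (h1 F⁻¹)

end Copies

theorem sum_rotate {α β γ S : Type*} [Fintype α] [Fintype β] [Fintype γ] [AddCommMonoid S]
    (f : α → β → γ → S) : ∑ a, ∑ b, ∑ c, f a b c = ∑ c, ∑ a, ∑ b, f a b c :=
  (Finset.sum_congr rfl fun _ _ => Finset.sum_comm).trans Finset.sum_comm

theorem sum_swap_pairs {α β γ δ S : Type*} [Fintype α] [Fintype β] [Fintype γ] [Fintype δ]
    [AddCommMonoid S] (f : α → β → γ → δ → S) :
    ∑ a, ∑ b, ∑ c, ∑ d, f a b c d = ∑ c, ∑ d, ∑ a, ∑ b, f a b c d :=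
  (sum_rotate _).trans (Finset.sum_congr rfl fun _ _ => sum_rotate _)

section Traces

variable {K : Type*} [Field K] {A : Type*} [Ring A] [Algebra K A] {N : ℕ}
variable (D : Matrix (Fin N) (Fin N) K)

theorem qtr1_emb_mul {m : ℕ} (X : Op N A m) (Y : Op N A (m + 1)) :
    qtr1 D (emb X * Y) = X * qtr1 D Y := by
  ext a b
  rw [Matrix.mul_apply]
  simp only [qtr1]
  simp only [emb_mul_apply, Finset.mul_sum]
  refine (sum_rotate _).trans (Finset.sum_congr rfl fun x _ => Finset.sum_congr rfl
    fun c _ => Finset.sum_congr rfl fun e _ => ?_)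
  rw [← mul_assoc, ← mul_assoc, Algebra.commutes]

theorem qtr1_mul_emb {m : ℕ} (X : Op N A m) (Y : Op N A (m + 1)) :
    qtr1 D (Y * emb X) = qtr1 D Y * X := by
  ext a b
  rw [Matrix.mul_apply]
  simp only [qtr1]
  simp only [mul_emb_apply, Finset.mul_sum, Finset.sum_mul]
  refine (sum_rotate _).trans ?_
  simp only [← mul_assoc]

theorem qtr1_smul {m : ℕ} (r : K) (X : Op N A (m + 1)) : qtr1 D (r • X) = r • qtr1 D X := by
  ext a b
  simp only [qtr1, Matrix.smul_apply, mul_smul_comm, Finset.smul_sum]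

theorem qtr1_one_eq_ptr1 {m : ℕ} (X : Op N A (m + 1)) :
    qtr1 (1 : Matrix (Fin N) (Fin N) K) X = ptr1 X := by
  ext a b
  simp [qtr1, ptr1, Matrix.one_apply]

/-- The coefficients appearing when a conjugated operator is traced over its last factor. -/
def traceCoeff (P Q : M2 N K) (a b i j : Fin N) : K :=
  ∑ c, ∑ e, ∑ s, D c e * P (a, e) (i, s) * Q (j, s) (b, c)

theorem qtr1_site_emb_site {m : ℕ} (P Q : M2 N K) (Z : Op N A (m + 1)) (a b : Fin m → Fin N)
    (c d : Fin N) :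
    qtr1 D (sc A (site (m + 2) m P) * emb Z * sc A (site (m + 2) m Q))
      (Fin.snoc a c) (Fin.snoc b d) =
      ∑ i, ∑ j, algebraMap K A (traceCoeff D P Q c d i j) * Z (Fin.snoc a i) (Fin.snoc b j) := by
  simp only [qtr1, ← site_map, mul_site_last_apply, site_last_mul_apply]
  have e : ∀ c' e', (∑ x, ∑ y, (∑ x_1, ∑ y_1, P.map (algebraMap K A) (c, e') (x_1, y_1) *
        emb Z (Fin.snoc (Fin.snoc a x_1 : Fin (m + 1) → Fin N) y_1)
          (Fin.snoc (Fin.snoc b x : Fin (m + 1) → Fin N) y)) *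
        Q.map (algebraMap K A) (x, y) (d, c')) =
      ∑ i, ∑ j, (∑ s, algebraMap K A (P (c, e') (i, s) * Q (j, s) (d, c'))) *
        Z (Fin.snoc a i) (Fin.snoc b j) := by
    intro c' e'
    rw [Finset.sum_comm' (t' := Finset.univ) (s' := fun _ => Finset.univ) (by simp)]
    simp only [emb_apply_snoc, mul_ite, mul_one, mul_zero, Finset.sum_ite_eq', Finset.mem_univ,
      if_true, Finset.sum_mul, Matrix.map_apply, map_mul]
    refine (sum_rotate _).trans (Finset.sum_congr rfl fun i _ => ?_)
    rw [Finset.sum_comm]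
    refine Finset.sum_congr rfl fun j _ => Finset.sum_congr rfl fun s _ => ?_
    rw [mul_assoc, mul_assoc, Algebra.commutes (Q _ _)]
  simp only [e, Finset.mul_sum]
  refine (sum_swap_pairs _).trans (Finset.sum_congr rfl fun i _ => Finset.sum_congr rfl
    fun j _ => ?_)
  simp only [traceCoeff, map_sum, map_mul, Finset.sum_mul, Finset.mul_sum, mul_assoc]

variable {F Ψ : M2 N K}

/-- Contraction with `F` in the crossed indices is injective. -/
theorem IsClosedPair.contract (hΨ : IsClosedPair F Ψ) (v w : Fin N → Fin N → K)
    (h : ∀ g f, ∑ b, ∑ d, v b d * F (g, b) (f, d) = ∑ b, ∑ d, w b d * F (g, b) (f, d)) :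
    v = w := by
  have hΨ' : ∀ a b c d : Fin N, _ = _ := hΨ
  have key : ∀ (v : Fin N → Fin N → K) (x y : Fin N),
      ∑ f, ∑ g, Ψ (x, f) (y, g) * ∑ b, ∑ d, v b d * F (g, b) (f, d) = v y x := by
    intro v x y
    calc _ = ∑ f, ∑ g, ∑ b, ∑ d, v b d * (Ψ (x, f) (y, g) * F (g, b) (f, d)) := by
          simp only [Finset.mul_sum, mul_left_comm]
      _ = ∑ b, ∑ d, v b d * if x = d ∧ b = y then 1 else 0 := by
          rw [sum_swap_pairs]
          simp only [← Finset.mul_sum, hΨ']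
      _ = v y x := by
          simp only [ite_and, mul_ite, mul_one, mul_zero, Finset.sum_ite_eq,
            Finset.sum_ite_eq', Finset.mem_univ, if_true]
  funext y x
  rw [← key v, ← key w]
  simp only [h]

/-- `Ψ` is also the inverse of `F` for the crossed product in the opposite order. -/
theorem IsClosedPair.symm (hΨ : IsClosedPair F Ψ) (f f' g g' : Fin N) :
    ∑ d, ∑ b, F (g, b) (f, d) * Ψ (d, f') (b, g') = if f = f' ∧ g = g' then 1 else 0 := by
  have h : (Matrix.of fun p r : Fin N × Fin N => Ψ (p.1, r.1) (p.2, r.2)) *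
      (Matrix.of fun r p : Fin N × Fin N => F (r.2, p.2) (r.1, p.1)) = 1 := by
    have hΨ' : ∀ a b c d : Fin N, _ = _ := hΨ
    ext ⟨a, c⟩ ⟨d, b⟩
    simp only [Matrix.mul_apply, Fintype.sum_prod_type, Matrix.of_apply, hΨ', Matrix.one_apply,
      Prod.mk.injEq]
    simp only [@eq_comm _ c b]
  have h' := congrArg (fun X => X (f, g) (f', g')) (mul_eq_one_comm.1 h)
  simpa only [Matrix.mul_apply, Fintype.sum_prod_type, Matrix.of_apply, Matrix.one_apply,
    Prod.mk.injEq] using h'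

theorem IsClosedPair.sum_Dmat_mul (hΨ : IsClosedPair F Ψ) (f g : Fin N) :
    ∑ c, ∑ e, Dmat Ψ c e * F (g, e) (f, c) = if g = f then 1 else 0 := by
  have := Finset.sum_congr rfl fun (h : Fin N) (_ : h ∈ Finset.univ) => hΨ.symm f h g h
  rw [← sum_rotate] at this
  simp only [Dmat, Finset.sum_mul]
  simp only [mul_comm (Ψ _ _), this]
  simp only [ite_and, Finset.sum_ite_eq, Finset.mem_univ, if_true]

/-- Tracing out the last copy of `F` gives the identity. -/
theorem IsClosedPair.qtr1_site (hΨ : IsClosedPair F Ψ) (m : ℕ) :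
    qtr1 (Dmat Ψ) (sc A (site (m + 2) m F)) = 1 := by
  refine op_ext fun a b c d => ?_
  simp only [qtr1, ← site_map, site_last_apply, Matrix.map_apply, one_apply_snoc]
  have := congrArg (algebraMap K A) (hΨ.sum_Dmat_mul d c)
  simp only [map_sum, map_mul] at this
  simp only [← mul_assoc, ← Finset.sum_mul, this]
  rw [Matrix.one_apply]
  by_cases h : a = b <;> by_cases h' : c = d <;> simp [h, h']

end Traces

noncomputable section Conjugation

variable {K : Type*} [Field K] {A : Type*} [Ring A] [Algebra K A] {N : ℕ}
variable {F Ψ : M2 N K}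

theorem traceCoeff_conj (hF : IsUnit F) (hΨ : IsClosedPair F Ψ) (hYB : YB F) (a b : Fin N) :
    traceCoeff (Dmat Ψ) F F⁻¹ a b = fun i j => if a = b then Dmat Ψ j i else 0 := by
  refine hΨ.contract _ _ fun x y => ?_
  have h0 : sc K (site 3 0 F) * sc K (site 3 0 F⁻¹) = 1 := by
    rw [← map_mul, ← site_mul', mul_inv_of_isUnit hF, site_one, map_one]
  have h0' : sc K (site 3 0 F⁻¹) * sc K (site 3 0 F) = 1 := by
    rw [← map_mul, ← site_mul', inv_mul_of_isUnit hF, site_one, map_one]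
  have h1 : sc K (site 3 1 F) * sc K (site 3 1 F⁻¹) = 1 := by
    rw [← map_mul, ← site_mul', mul_inv_of_isUnit hF, site_one, map_one]
  have hb : sc K (site 3 0 F) * sc K (site 3 1 F) * sc K (site 3 0 F) =
      sc K (site 3 1 F) * sc K (site 3 0 F) * sc K (site 3 1 F) := by
    simp only [← map_mul]
    exact congrArg _ hYB
  have h2 : sc K (site 3 1 F) * emb (sc K (site 2 0 F)) * sc K (site 3 1 F⁻¹) =
      emb (sc K (site 2 0 F⁻¹)) * sc K (site 3 1 F) * emb (sc K (site 2 0 F)) := by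
    rw [emb_sc, emb_sc, emb_site (by omega), emb_site (by omega)]
    calc _ = sc K (site 3 0 F⁻¹) * sc K (site 3 0 F) * (sc K (site 3 1 F) * sc K (site 3 0 F) *
          sc K (site 3 1 F⁻¹)) := by rw [h0', one_mul]
      _ = sc K (site 3 0 F⁻¹) * (sc K (site 3 0 F) * sc K (site 3 1 F) * sc K (site 3 0 F)) *
          sc K (site 3 1 F⁻¹) := by simp only [mul_assoc]
      _ = sc K (site 3 0 F⁻¹) * (sc K (site 3 1 F) * sc K (site 3 0 F) * sc K (site 3 1 F)) *
          sc K (site 3 1 F⁻¹) := by rw [hb]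
      _ = sc K (site 3 0 F⁻¹) * sc K (site 3 1 F) * sc K (site 3 0 F) *
          (sc K (site 3 1 F) * sc K (site 3 1 F⁻¹)) := by simp only [mul_assoc]
      _ = _ := by rw [h1, mul_one]
  have h3 := congrArg (qtr1 (Dmat Ψ)) h2
  rw [qtr1_mul_emb, qtr1_emb_mul, hΨ.qtr1_site, mul_one, ← map_mul, ← site_mul',
    inv_mul_of_isUnit hF, site_one, map_one] at h3
  have h4 := congrArg (fun X : Op N K 2 =>
    X (Fin.snoc (Fin.snoc (Fin.elim0 : Fin 0 → Fin N) x : Fin 1 → Fin N) a)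
      (Fin.snoc (Fin.snoc (Fin.elim0 : Fin 0 → Fin N) y : Fin 1 → Fin N) b)) h3
  have h5 := qtr1_site_emb_site (A := K) (m := 1) (Dmat Ψ) F F⁻¹ (sc K (site 2 0 F))
    (Fin.snoc (Fin.elim0 : Fin 0 → Fin N) x) (Fin.snoc (Fin.elim0 : Fin 0 → Fin N) y) a b
  simp only [sc_apply, Algebra.algebraMap_self, RingHom.id_apply, site_last_apply, if_true,
    mul_one] at h5
  rw [← h5]
  refine h4.trans ?_
  simp only [one_apply_snoc]
  by_cases hab : a = b
  · simp only [hab, if_true]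
    rw [Finset.sum_comm, hΨ.sum_Dmat_mul]
    simp
  · simp [hab]

/-- Conjugating by the last copy of `F` turns a trace over the last factor into a trace over
the previous one. -/
theorem qtr1_conj (hF : IsUnit F) (hΨ : IsClosedPair F Ψ) (hYB : YB F) {m : ℕ}
    (X : Op N A (m + 1)) :
    qtr1 (Dmat Ψ) (sc A (site (m + 2) m F) * emb X * sc A (site (m + 2) m F⁻¹)) =
      emb (qtr1 (Dmat Ψ) X) := by
  refine op_ext fun a b c d => ?_
  rw [qtr1_site_emb_site, traceCoeff_conj hF hΨ hYB, emb_apply_snoc, Finset.sum_comm]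
  by_cases h : c = d <;> simp [h, qtr1]

end Conjugation

noncomputable section Twist

variable {K : Type*} [Field K] {N : ℕ}

/-- Two-site operators that can be moved to the left through `F₂F₁`. -/
def LeftCompat (F X : M2 N K) : Prop :=
  SemiconjBy (site 3 1 F * site 3 0 F) (site 3 1 X) (site 3 0 X)

/-- Two-site operators that can be moved to the right through `F₁F₂`. -/
def RightCompat (F X : M2 N K) : Prop :=
  SemiconjBy (site 3 0 F * site 3 1 F) (site 3 0 X) (site 3 1 X)

variable {F X Y : M2 N K}

theorem LeftCompat.mul (hX : LeftCompat F X) (hY : LeftCompat F Y) : LeftCompat F (X * Y) := by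
  rw [LeftCompat, site_mul', site_mul']
  exact SemiconjBy.mul_right hX hY

theorem RightCompat.mul (hX : RightCompat F X) (hY : RightCompat F Y) :
    RightCompat F (X * Y) := by
  rw [RightCompat, site_mul', site_mul']
  exact SemiconjBy.mul_right hX hY

theorem LeftCompat.inv (hX : LeftCompat F X) (hu : IsUnit X) : LeftCompat F X⁻¹ :=
  SemiconjBy.units_inv_right (x := siteUnit K hu 3 1) (y := siteUnit K hu 3 0) hX

theorem RightCompat.inv (hX : RightCompat F X) (hu : IsUnit X) : RightCompat F X⁻¹ :=
  SemiconjBy.units_inv_right (x := siteUnit K hu 3 0) (y := siteUnit K hu 3 1) hX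

theorem LeftCompat.rel (hX : LeftCompat F X) :
    site 3 0 X * site 3 1 F * site 3 0 F = site 3 1 F * site 3 0 F * site 3 1 X := by
  rw [mul_assoc]
  exact SemiconjBy.eq (h := hX) |>.symm

theorem YB.leftCompat (h : YB F) : LeftCompat F F := by
  have h' : _ = _ := h
  rw [LeftCompat, SemiconjBy, ← h', mul_assoc]

theorem YB.rightCompat (h : YB F) : RightCompat F F := by
  have h' : _ = _ := h
  rw [RightCompat, SemiconjBy, h', mul_assoc]

variable {R : M2 N K}

theorem Compatible.left (h : Compatible R F) : LeftCompat F R := by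
  have h' : _ = _ := h.2.2.1
  rw [LeftCompat, SemiconjBy, ← h', mul_assoc]

theorem Compatible.right (h : Compatible R F) : RightCompat F R := by
  have h' : _ = _ := h.2.2.2
  rw [RightCompat, SemiconjBy, h', mul_assoc]

theorem Compatible.left_RFF (h : Compatible R F) (hF : IsUnit F) : LeftCompat F (RFF R F) :=
  ((h.2.1.leftCompat.mul ((h.2.1.leftCompat.mul h.left).mul (h.2.1.leftCompat.inv hF))).mul
    (h.2.1.leftCompat.inv hF))

theorem Compatible.right_RFF (h : Compatible R F) (hF : IsUnit F) : RightCompat F (RFF R F) :=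
  ((h.2.1.rightCompat.mul ((h.2.1.rightCompat.mul h.right).mul (h.2.1.rightCompat.inv hF))).mul
    (h.2.1.rightCompat.inv hF))

end Twist

noncomputable section TwistTrace

variable {K : Type*} [Field K] {A : Type*} [Ring A] [Algebra K A] {N : ℕ}

theorem sc_self {m : ℕ} (X : Op N K m) : sc K X = X := rfl

theorem qtr1_qtr1 (D : Matrix (Fin N) (Fin N) K) {m : ℕ} (X : Op N A (m + 2)) :
    qtr1 D (qtr1 D X) = ptr1 (ptr1 (sc A (site (m + 2) m (Matrix.kronecker D D)) * X)) := by
  have e : ∀ c c' x y, Matrix.kronecker D D (c, c') (x, y) = D c x * D c' y :=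
    fun _ _ _ _ => rfl
  ext a b
  simp only [qtr1, ptr1, ← site_map, site_last_mul_apply, Matrix.map_apply, e, Finset.mul_sum, map_mul, mul_assoc]
  exact Finset.sum_congr rfl fun c _ => Finset.sum_comm

theorem ptr1_ptr1_cyclic {m : ℕ} (Y : M2 N K) (X : Op N A (m + 2)) :
    ptr1 (ptr1 (sc A (site (m + 2) m Y) * X)) = ptr1 (ptr1 (X * sc A (site (m + 2) m Y))) := by
  ext a b
  simp only [ptr1, ← site_map, site_last_mul_apply, mul_site_last_apply, Matrix.map_apply]
  rw [sum_swap_pairs]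
  simp only [Algebra.commutes]

variable {R F Ψ : M2 N K}

/-- The two-site operator obtained from `Y₂F₁F₂` by tracing out the last factor. -/
def traceF (F Y : M2 N K) : M2 N K :=
  Matrix.of fun p r => ∑ i, ∑ j, traceCoeff 1 Y F p.2 r.2 i j * F (p.1, i) (r.1, j)

theorem ptr1_site_mul (m : ℕ) (Y : M2 N K) :
    ptr1 (site (m + 3) (m + 1) Y * site (m + 3) m F * site (m + 3) (m + 1) F) =
      site (m + 2) m (traceF F Y) := by
  refine op_ext fun a b c d => ?_
  have := qtr1_site_emb_site (A := K) (m := m + 1) 1 Y F (site (m + 2) m F) a b c d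
  rw [qtr1_one_eq_ptr1, emb_site (by omega)] at this
  refine this.trans ?_
  rw [← Fin.snoc_init_self a, ← Fin.snoc_init_self b]
  simp only [site_last_apply, traceF, Matrix.of_apply, Finset.sum_mul, mul_assoc,
    Algebra.algebraMap_self, RingHom.id_apply]

theorem traceF_injective (hΨ : IsClosedPair F Ψ) : Function.Injective (traceF F) := by
  intro Y Z h
  have h1 : ∀ a b, traceCoeff 1 Y F a b = traceCoeff 1 Z F a b := fun a b =>
    hΨ.contract _ _ fun x y => congrArg (fun W : M2 N K => W (x, a) (y, b)) h
  have h2 : ∀ a i, (fun s c => Y (a, c) (i, s)) = fun s c => Z (a, c) (i, s) := fun a i =>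
    hΨ.contract _ _ fun j b => by
      have := congrFun (congrFun (h1 a b) i) j
      simp only [traceCoeff, Matrix.one_apply, ite_mul, one_mul, zero_mul] at this
      rw [Finset.sum_comm, Finset.sum_comm (f := fun s c => Z (a, c) (i, s) * F (j, s) (b, c))]
      simpa using this
  ext ⟨a, c⟩ ⟨i, s⟩
  exact congrFun (congrFun (h2 a i) s) c

theorem site_two_injective : Function.Injective (site (N := N) (A := K) 2 0) := by
  intro Y Z h
  ext ⟨a, c⟩ ⟨i, s⟩
  have := congrArg (fun W : Op N K 2 =>
    W (Fin.snoc (Fin.snoc (Fin.elim0 : Fin 0 → Fin N) a : Fin 1 → Fin N) c)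
      (Fin.snoc (Fin.snoc (Fin.elim0 : Fin 0 → Fin N) i : Fin 1 → Fin N) s)) h
  simpa only [site_last_apply (m := 0), if_true, mul_one] using this

/-- The operator interchanging the first and the last pair of factors of `V^{⊗4}`. -/
def cable (F : M2 N K) : Op N K 4 := site 4 1 F * site 4 0 F * site 4 2 F * site 4 1 F

theorem cable_right {X : M2 N K} (hX : LeftCompat F X) :
    site 4 0 X * cable F = cable F * site 4 2 X := by
  have h1 := three_transport (A := K) (m := 4) (i := 0) (s := 0) (t := 1) (u := 0) (s' := 1)
    (t' := 0) (u' := 1) (by omega) hX.rel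
  have h2 := three_transport (A := K) (m := 4) (i := 1) (s := 0) (t := 1) (u := 0) (s' := 1)
    (t' := 0) (u' := 1) (by omega) hX.rel
  simp only [sc_self, Fin.isValue, Fin.val_one, Fin.val_zero, add_zero, zero_add,
    Nat.reduceAdd] at h1 h2
  rw [cable, mul_assoc, mul_assoc, ← mul_assoc (site 4 0 F), ← mul_assoc, ← mul_assoc]
  calc _ = (site 4 0 X * site 4 1 F * site 4 0 F) * site 4 2 F * site 4 1 F := by
        simp only [mul_assoc]
    _ = site 4 1 F * site 4 0 F * (site 4 1 X * site 4 2 F * site 4 1 F) := by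
        rw [h1]; simp only [mul_assoc]
    _ = _ := by rw [h2]; simp only [mul_assoc]

theorem site_commute_four (X Y : M2 N K) : site 4 0 X * site 4 2 Y = site 4 2 Y * site 4 0 X :=
  commute_site (by omega) (by omega) X Y

theorem cable_left {X : M2 N K} (hX : RightCompat F X) :
    site 4 2 X * cable F = cable F * site 4 0 X := by
  have hX' : site 3 0 F * site 3 1 F * site 3 0 X = site 3 1 X * site 3 0 F * site 3 1 F := by
    rw [mul_assoc (site 3 1 X)]
    exact SemiconjBy.eq (h := hX)
  have h1 := three_transport (A := K) (m := 4) (i := 0) (s := 0) (t := 1) (u := 0) (s' := 1)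
    (t' := 0) (u' := 1) (by omega) hX'
  have h2 := three_transport (A := K) (m := 4) (i := 1) (s := 0) (t := 1) (u := 0) (s' := 1)
    (t' := 0) (u' := 1) (by omega) hX'
  simp only [sc_self, Fin.isValue, Fin.val_one, Fin.val_zero, add_zero, zero_add,
    Nat.reduceAdd] at h1 h2
  have e : cable F = site 4 1 F * site 4 2 F * (site 4 0 F * site 4 1 F) := by
    simp only [cable, mul_assoc]
    rw [← mul_assoc (site 4 0 F), site_commute_four]
    simp only [mul_assoc]
  rw [e]
  calc _ = (site 4 2 X * site 4 1 F * site 4 2 F) * (site 4 0 F * site 4 1 F) := by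
        simp only [mul_assoc]
    _ = site 4 1 F * site 4 2 F * (site 4 1 X * site 4 0 F * site 4 1 F) := by
        rw [← h2]; simp only [mul_assoc]
    _ = _ := by rw [← h1]; simp only [mul_assoc]

theorem ptr1_cable (Y : M2 N K) :
    ptr1 (ptr1 (site 4 2 Y * cable F)) = site 2 0 (traceF F (traceF F Y)) := by
  have e : site 4 2 Y * cable F =
      (site 4 2 Y * site 4 1 F * site 4 2 F) * emb (site 3 0 F * site 3 1 F) := by
    rw [map_mul, emb_site (by omega), emb_site (by omega), cable]
    simp only [mul_assoc]
    rw [← mul_assoc (site 4 0 F), site_commute_four]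
    simp only [mul_assoc]
  rw [e, ← qtr1_one_eq_ptr1 (K := K) (_ * _), qtr1_mul_emb, qtr1_one_eq_ptr1,
    ptr1_site_mul (m := 1), ← ptr1_site_mul (m := 0), mul_assoc]

theorem qtr1_cable (hΨ : IsClosedPair F Ψ) (h : YB F) :
    qtr1 (Dmat Ψ) (qtr1 (Dmat Ψ) (cable F)) = site 2 0 (F * F) := by
  have e : cable F = emb (site 3 1 F * site 3 0 F) * sc K (site 4 2 F) * emb (site 3 1 F) := by
    rw [map_mul, emb_site (by omega), emb_site (by omega)]
    rfl
  have h' : site 3 0 F * site 3 1 F * site 3 0 F = _ := h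
  have e' : site 3 1 F * site 3 0 F * site 3 1 F =
      emb (site 2 0 F) * sc K (site 3 1 F) * emb (site 2 0 F) := by
    rw [emb_site (by omega), ← h']
    rfl
  rw [e, qtr1_mul_emb, qtr1_emb_mul, hΨ.qtr1_site, mul_one, e', qtr1_mul_emb, qtr1_emb_mul,
    hΨ.qtr1_site, mul_one, site_mul']

/-- The square of `D` intertwines `R` and its double twist. -/
theorem kronecker_Dmat_mul (hF : IsUnit F) (hΨ : IsClosedPair F Ψ) (h : Compatible R F) :
    Matrix.kronecker (Dmat Ψ) (Dmat Ψ) * R = RFF R F * Matrix.kronecker (Dmat Ψ) (Dmat Ψ) := by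
  apply traceF_injective hΨ
  apply traceF_injective hΨ
  apply site_two_injective
  rw [← ptr1_cable, ← ptr1_cable]
  have t := fun X : Op N K 4 => qtr1_qtr1 (A := K) (Dmat Ψ) X
  have e0 : ∀ (X : M2 N K), site 4 0 X = emb (emb (site 2 0 X)) := fun X => by
    rw [emb_site (by omega), emb_site (by omega)]
  have hl : ptr1 (ptr1 (site 4 2 (Matrix.kronecker (Dmat Ψ) (Dmat Ψ) * R) * cable F)) =
      site 2 0 (F * F) * site 2 0 R := by
    rw [site_mul', mul_assoc, ← sc_self (site 4 2 (Matrix.kronecker _ _)), ← t,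
      cable_left h.right, e0, qtr1_mul_emb, qtr1_mul_emb, qtr1_cable hΨ h.2.1]
  have hr : ptr1 (ptr1 (site 4 2 (RFF R F * Matrix.kronecker (Dmat Ψ) (Dmat Ψ)) * cable F)) =
      site 2 0 (RFF R F) * site 2 0 (F * F) := by
    rw [site_mul', mul_assoc, ← sc_self (site 4 2 (RFF R F)), ptr1_ptr1_cyclic (m := 2),
      mul_assoc, sc_self, ← cable_right (h.left_RFF hF),
      ← sc_self (site 4 2 (Matrix.kronecker _ _)), ← t, e0, qtr1_emb_mul, qtr1_emb_mul,
      qtr1_cable hΨ h.2.1]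
  rw [hl, hr, ← site_mul', ← site_mul']
  congr 1
  have hi := inv_mul_of_isUnit hF
  simp only [RFF, mul_assoc]
  rw [← mul_assoc F⁻¹ F F, hi, one_mul, hi, mul_one]

end TwistTrace

noncomputable section Cyclic

variable {K : Type*} [Field K] {A : Type*} [Ring A] [Algebra K A] {N : ℕ}
variable (D : Matrix (Fin N) (Fin N) K)

theorem qtr1_sub {m : ℕ} (X Y : Op N A (m + 1)) : qtr1 D (X - Y) = qtr1 D X - qtr1 D Y := by
  ext a b
  simp only [qtr1, Matrix.sub_apply, mul_sub, Finset.sum_sub_distrib]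

theorem qtrs_sub {m : ℕ} : ∀ (j : ℕ) (X Y : Op N A (m + j)),
    qtrs D m j (X - Y) = qtrs D m j X - qtrs D m j Y
  | 0, _, _ => rfl
  | j + 1, X, Y => by
      rw [qtrs, qtrs, qtrs, ← qtrs_sub j]
      exact congrArg _ (qtr1_sub D X Y)

theorem qtrs_smul {m : ℕ} : ∀ (j : ℕ) (r : K) (X : Op N A (m + j)),
    qtrs D m j (r • X) = r • qtrs D m j X
  | 0, _, _ => rfl
  | j + 1, r, X => by
      rw [qtrs, qtrs, ← qtrs_smul j]
      exact congrArg _ (qtr1_smul D r X)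

/-- If `D ⊗ D` intertwines `R` and `R'`, these can be moved around a trace. -/
theorem qtrs_site_cyclic {R R' : M2 N K}
    (hD : Matrix.kronecker D D * R = R' * Matrix.kronecker D D) {m i : ℕ} (hi : m ≤ i) :
    ∀ (j : ℕ), i + 1 < m + j → ∀ X : Op N A (m + j),
      qtrs D m j (sc A (site (m + j) i R) * X) = qtrs D m j (X * sc A (site (m + j) i R'))
  | 0, h, _ => by omega
  | j + 1, h, X => by
      rcases Nat.lt_or_ge (i + 1) (m + j) with h' | h'
      · have e : ∀ Y : M2 N K, sc A (site (m + (j + 1)) i Y) = emb (sc A (site (m + j) i Y)) :=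
          fun Y => by rw [emb_sc, emb_site h']; rfl
        rw [e, e, qtrs, qtrs]
        have e1 := qtr1_emb_mul D (sc A (site (m + j) i R)) X
        have e2 := qtr1_mul_emb D (sc A (site (m + j) i R')) X
        refine (congrArg _ e1).trans (Eq.trans ?_ (congrArg _ e2).symm)
        exact qtrs_site_cyclic hD hi j h' _
      · obtain ⟨t, rfl⟩ : ∃ t, i = m + t := ⟨i - m, by omega⟩
        obtain rfl : j = t + 1 := by omega
        rw [qtrs, qtrs, qtrs, qtrs]
        congr 1
        change qtr1 D (qtr1 D (sc A (site (m + t + 2) (m + t) R) * X)) =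
          qtr1 D (qtr1 D (X * sc A (site (m + t + 2) (m + t) R')))
        rw [qtr1_qtr1, qtr1_qtr1, ← mul_assoc, ← map_mul, ← site_mul', hD, site_mul', map_mul,
          mul_assoc, ptr1_ptr1_cyclic, mul_assoc]
        rfl

theorem qtrs_qasym_cyclic {R R' : M2 N K}
    (hD : Matrix.kronecker D D * R = R' * Matrix.kronecker D D) (q : K) {m j p k : ℕ}
    (hp : m ≤ p) (hk : p + k ≤ m + j) (X : Op N A (m + j)) :
    qtrs D m j (sc A (qasym q R (m + j) p k) * X) =
      qtrs D m j (X * sc A (qasym q R' (m + j) p k)) := by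
  rw [qasym_eq_hasym, qasym_eq_hasym]
  refine hasym_rel q (fun x x' => ∀ X : Op N A (m + j),
    qtrs D m j (sc A x * X) = qtrs D m j (X * sc A x')) ?_ ?_ ?_ ?_ _ _ k ?_ X
  · intro X
    rw [map_one, one_mul, mul_one]
  · intro x y x' y' h h' X
    rw [map_mul, map_mul, mul_assoc, h, mul_assoc, h', mul_assoc]
  · intro x y x' y' h h' X
    rw [map_sub, map_sub, sub_mul, mul_sub, qtrs_sub, qtrs_sub, h, h']
  · intro r x x' h X
    rw [map_smul, map_smul, smul_mul_assoc, mul_smul_comm, qtrs_smul, qtrs_smul, h]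
  · intro i hi X
    exact qtrs_site_cyclic D hD (by omega) j (by omega) X

end Cyclic

noncomputable section Generators

theorem conj_mul_conj_conj {B : Type*} [Ring B] (f g : Bˣ) (x : B) (hg : Commute (g : B) x)
    (hb : f * g * f = g * f * g) :
    f * x * (f⁻¹ : Bˣ) * (g * (f * x * (f⁻¹ : Bˣ)) * (g⁻¹ : Bˣ)) =
      (f * g : Bˣ) * (x * (f * x * (f⁻¹ : Bˣ))) * ((f * g)⁻¹ : Bˣ) := by
  have h1 : f⁻¹ * g⁻¹ = g * f⁻¹ * (f * g)⁻¹ := by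
    rw [eq_mul_inv_iff_mul_eq, mul_assoc, inv_mul_eq_iff_eq_mul, inv_mul_eq_iff_eq_mul,
      eq_comm, ← mul_assoc, ← mul_assoc, mul_inv_eq_iff_eq_mul, hb]
  have h2 : f⁻¹ * (g * f * g) = g * f := by
    rw [← hb, mul_assoc, inv_mul_cancel_left]
  have h1' := congrArg Units.val h1
  have h2' := congrArg Units.val h2
  simp only [Units.val_mul] at h1' h2' ⊢
  calc (f : B) * x * (f⁻¹ : Bˣ) * (g * (f * x * (f⁻¹ : Bˣ)) * (g⁻¹ : Bˣ))
      = f * x * (f⁻¹ : Bˣ) * g * f * x * ((f⁻¹ : Bˣ) * (g⁻¹ : Bˣ)) := by noncomm_ring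
    _ = f * x * (f⁻¹ : Bˣ) * g * f * (x * g) * (f⁻¹ : Bˣ) * ((f * g)⁻¹ : Bˣ) := by
      rw [h1']; noncomm_ring
    _ = f * x * ((f⁻¹ : Bˣ) * (g * f * g)) * x * (f⁻¹ : Bˣ) * ((f * g)⁻¹ : Bˣ) := by
      rw [← hg.eq]; noncomm_ring
    _ = f * (x * g) * f * x * (f⁻¹ : Bˣ) * ((f * g)⁻¹ : Bˣ) := by
      rw [h2']; noncomm_ring
    _ = f * g * (x * (f * x * (f⁻¹ : Bˣ))) * ((f * g)⁻¹ : Bˣ) := by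
      rw [← hg.eq]; noncomm_ring

variable {K : Type*} [Field K] {A : Type*} [Ring A] [Algebra K A] {N : ℕ}
variable {R F : M2 N K} {M : Matrix (Fin N) (Fin N) A}

theorem semiconj_Mb_zero (hM : IsGenerators R F M) {m : ℕ} (hm : 2 ≤ m) :
    SemiconjBy (Mb F M m 0 * Mb F M m 1) (sc A (site m 0 (RFF R F))) (sc A (site m 0 R)) := by
  induction m, hm using Nat.le_induction with
  | base =>
    have : _ = _ := hM
    simp only [site_map, MbarSeg, one_mul, zero_add] at this
    exact this.symm
  | succ m hm ih =>
    have := ih.map (emb (N := N) (A := A))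
    rwa [map_mul, emb_Mb F M (by omega), emb_Mb F M (by omega), emb_sc, emb_sc,
      emb_site (by omega), emb_site (by omega)] at this

theorem RightCompat.semiconj {X : M2 N K} (hX : RightCompat F X) {m i : ℕ} (hi : i + 2 < m) :
    SemiconjBy (sc A (site m i F) * sc A (site m (i + 1) F)) (sc A (site m i X))
      (sc A (site m (i + 1) X)) := by
  have hX' : site 3 0 F * site 3 1 F * site 3 0 X = site 3 1 X * site 3 0 F * site 3 1 F := by
    rw [mul_assoc (site 3 1 X)]
    exact SemiconjBy.eq (h := hX)
  have h1 := three_transport (A := A) (m := m) (i := i) (s := 0) (t := 1) (u := 0) (s' := 1)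
    (t' := 0) (u' := 1) (by omega) hX'
  simp only [Fin.isValue, Fin.val_one, Fin.val_zero, add_zero] at h1
  rw [SemiconjBy, h1, mul_assoc]

theorem semiconj_Mb (h : Compatible R F) (hF : IsUnit F) (hM : IsGenerators R F M) {m : ℕ} :
    ∀ {i : ℕ}, i + 1 < m → SemiconjBy (Mb F M m i * Mb F M m (i + 1))
      (sc A (site m i (RFF R F))) (sc A (site m i R))
  | 0, hi => semiconj_Mb_zero hM (by omega)
  | i + 1, hi => by
      have ih := semiconj_Mb h hF hM (m := m) (i := i) (by omega)
      have hb : siteUnit A hF m i * siteUnit A hF m (i + 1) * siteUnit A hF m i =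
          siteUnit A hF m (i + 1) * siteUnit A hF m i * siteUnit A hF m (i + 1) := by
        have h1 := three_transport (A := A) (m := m) (i := i) (s := 0) (t := 1) (u := 0)
          (s' := 1) (t' := 0) (u' := 1) (by omega) h.2.1
        exact Units.ext h1
      have e := conj_mul_conj_conj (siteUnit A hF m i) (siteUnit A hF m (i + 1)) (Mb F M m i)
        (commute_Mb_right F M (by omega) (by omega) F) hb
      rw [Mb_succ F M m (i + 1), Mb_succ F M m i, ← siteUnit_val hF, ← siteUnit_inv hF,
        ← siteUnit_val hF, ← siteUnit_inv hF, e, siteUnit_val, siteUnit_inv, ← Mb_succ]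
      have u : ∀ {X : M2 N K}, RightCompat F X → SemiconjBy
          ((siteUnit A hF m i * siteUnit A hF m (i + 1) : (Op N A m)ˣ) : Op N A m)
          (sc A (site m i X)) (sc A (site m (i + 1) X)) := fun hX => hX.semiconj (by omega)
      exact ((u h.right).mul_left ih).mul_left (u (h.right_RFF hF)).units_inv_symm_left

/-- The ordered products of copies of `M`. -/
abbrev Mseg (F : M2 N K) (M : Matrix (Fin N) (Fin N) A) (m i l : ℕ) : Op N A m :=
  MbarSeg m (F.map (algebraMap K A)) ((F⁻¹).map (algebraMap K A)) M i l

theorem Mseg_succ (m i l : ℕ) : Mseg F M m i (l + 1) = Mseg F M m i l * Mb F M m (i + l) := rfl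

theorem Mseg_add (m i l : ℕ) : ∀ l', Mseg F M m i (l + l') =
    Mseg F M m i l * Mseg F M m (i + l) l'
  | 0 => (mul_one _).symm
  | l' + 1 => by
      rw [← add_assoc, Mseg_succ, Mseg_succ, Mseg_add m i l l', mul_assoc, add_assoc]

theorem emb_Mseg {m i : ℕ} : ∀ {l : ℕ}, i + l ≤ m →
    emb (Mseg F M m i l) = Mseg F M (m + 1) i l
  | 0, _ => map_one _
  | l + 1, h => by
      rw [Mseg_succ, Mseg_succ, map_mul, emb_Mseg (by omega), emb_Mb F M (by omega)]

theorem commute_Mseg_right {m j i : ℕ} (hj : j + 1 < m) (X : M2 N K) :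
    ∀ {l : ℕ}, i + l ≤ j → Commute (sc A (site m j X)) (Mseg F M m i l)
  | 0, _ => Commute.one_right _
  | l + 1, h => by
      rw [Mseg_succ]
      exact (commute_Mseg_right hj X (by omega)).mul_right
        (commute_Mb_right F M (by omega) hj X)

theorem semiconj_Mseg (h : Compatible R F) (hF : IsUnit F) (hM : IsGenerators R F M)
    {m p i : ℕ} (hp : p ≤ i) : ∀ {l : ℕ}, i + 1 < p + l → p + l ≤ m →
    SemiconjBy (Mseg F M m p l) (sc A (site m i (RFF R F))) (sc A (site m i R))
  | 0, h1, _ => by omega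
  | l + 1, h1, h2 => by
      rcases Nat.lt_or_ge (i + 1) (p + l) with h' | h'
      · rw [Mseg_succ]
        exact (semiconj_Mseg h hF hM hp h' (by omega)).mul_left
          (commute_Mb_left M hF (h.left_RFF hF).rel (by omega) (by omega)).symm
      · obtain ⟨t, rfl⟩ : ∃ t, i = p + t := ⟨i - p, by omega⟩
        obtain rfl : l = t + 1 := by omega
        have e : Mseg F M m p (t + 1 + 1) =
            Mseg F M m p t * (Mb F M m (p + t) * Mb F M m (p + t + 1)) := mul_assoc _ _ _
        have h3 : SemiconjBy (Mseg F M m p t) (sc A (site m (p + t) R))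
            (sc A (site m (p + t) R)) :=
          (commute_Mseg_right (F := F) (M := M) (by omega) R le_rfl).symm
        have h4 := semiconj_Mb h hF hM (m := m) (i := p + t) (by omega)
        exact e ▸ h3.mul_left h4

theorem semiconj_Mseg_qasym (h : Compatible R F) (hF : IsUnit F) (hM : IsGenerators R F M)
    (q : K) {m p l p' k : ℕ} (hp : p ≤ p') (hk : p' + k ≤ p + l) (hl : p + l ≤ m) :
    SemiconjBy (Mseg F M m p l) (sc A (qasym q (RFF R F) m p' k)) (sc A (qasym q R m p' k)) := by
  rw [qasym_eq_hasym, qasym_eq_hasym, map_hasym, map_hasym]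
  exact hasym_semiconj q _ _ _ k fun i hi =>
    semiconj_Mseg h hF hM (by omega) (by omega) hl

end Generators

noncomputable section Casts

variable {K : Type*} [Field K] {A : Type*} [Ring A] [Algebra K A] {N : ℕ}

/-- Operators on equal tensor powers. -/
def castOp {m m' : ℕ} (h : m = m') : Op N A m →+* Op N A m' :=
  h ▸ RingHom.id (Op N A m)

theorem castOp_eq {m m' : ℕ} (h : m = m') (f : ∀ m, Op N A m) : castOp h (f m) = f m' := by
  subst h
  rfl

theorem qtr1_castOp (D : Matrix (Fin N) (Fin N) K) {m m' : ℕ} (h : m = m') (X : Op N A (m + 1)) :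
    qtr1 D (castOp (congrArg Nat.succ h) X) = castOp h (qtr1 D X) := by
  subst h
  rfl

theorem qtrs_castOp (D : Matrix (Fin N) (Fin N) K) (m j : ℕ) :
    ∀ (i : ℕ) (X : Op N A (m + (j + i))),
      qtrs D m (j + i) X = qtrs D m j (qtrs D (m + j) i (castOp (add_assoc m j i).symm X))
  | 0, _ => rfl
  | i + 1, X => by
      have e := qtr1_castOp D (add_assoc m j i).symm X
      exact (qtrs_castOp D m j i (qtr1 D X)).trans
        (congrArg (fun Y => qtrs D m j (qtrs D (m + j) i Y)) e.symm)

/-- Adding several tensor factors. -/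
def embs {m : ℕ} : (i : ℕ) → Op N A m → Op N A (m + i)
  | 0, X => X
  | i + 1, X => emb (embs i X)

theorem qtrs_embs_mul (D : Matrix (Fin N) (Fin N) K) {m : ℕ} (X : Op N A m) :
    ∀ (i : ℕ) (Y : Op N A (m + i)), qtrs D m i (embs i X * Y) = X * qtrs D m i Y
  | 0, _ => rfl
  | i + 1, Y => by
      have e := qtr1_emb_mul D (embs i X) Y
      exact (congrArg (qtrs D m i) e).trans (qtrs_embs_mul D X i (qtr1 D Y))

theorem qtrAll_qtr1 (D : Matrix (Fin N) (Fin N) K) {m : ℕ} (X : Op N A (m + 1)) :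
    qtrAll D (qtr1 D X) = qtrAll D X := by
  simp only [qtrAll, qtr1, sum_snoc, Fin.prod_univ_castSucc, Fin.snoc_castSucc, Fin.snoc_last,
    map_mul, Finset.mul_sum, mul_assoc]
  refine Finset.sum_congr rfl fun a _ => ?_
  rw [Finset.sum_comm]

theorem qtrAll_qtrs (D : Matrix (Fin N) (Fin N) K) {m : ℕ} :
    ∀ (j : ℕ) (X : Op N A (m + j)), qtrAll D (qtrs D m j X) = qtrAll D X
  | 0, _ => rfl
  | j + 1, X => (qtrAll_qtrs D j (qtr1 D X)).trans (qtrAll_qtr1 D X)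

theorem eq_qtrAll_smul_one (D : Matrix (Fin N) (Fin N) K) (X : Op N A 0) :
    X = qtrAll D X • 1 := by
  ext a b
  rw [Subsingleton.elim a default, Subsingleton.elim b default]
  simp [qtrAll]

theorem emb_smul_one {m : ℕ} (s : A) : emb (s • (1 : Op N A m)) = s • 1 :=
  op_ext fun a b c d => by
    rw [emb_apply_snoc]
    simp only [Matrix.smul_apply, one_apply_snoc, smul_eq_mul, mul_assoc]

end Casts

noncomputable section Shifts

variable {K : Type*} [Field K] {A : Type*} [Ring A] [Algebra K A] {N : ℕ}
variable {R F Ψ : M2 N K} {M : Matrix (Fin N) (Fin N) A}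

variable (A) in
/-- The product `F_p F_{p+1} ⋯ F_{p+l-1}` as an invertible operator. -/
def chainUnit (hF : IsUnit F) (m p : ℕ) : ℕ → (Op N A m)ˣ
  | 0 => 1
  | l + 1 => chainUnit hF m p l * siteUnit A hF m (p + l)

theorem map_emb_siteUnit (hF : IsUnit F) {m i : ℕ} (h : i + 1 < m) :
    Units.map (emb (N := N) (A := A) (m := m) : Op N A m →* Op N A (m + 1)) (siteUnit A hF m i) =
      siteUnit A hF (m + 1) i := by
  refine Units.ext ?_
  change emb (sc A (site m i F)) = sc A (site (m + 1) i F)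
  rw [emb_sc, emb_site h]

theorem map_emb_chainUnit (hF : IsUnit F) {m p : ℕ} : ∀ {l : ℕ}, p + l < m →
    Units.map (emb (N := N) (A := A) (m := m) : Op N A m →* Op N A (m + 1))
      (chainUnit A hF m p l) = chainUnit A hF (m + 1) p l
  | 0, _ => map_one _
  | l + 1, h => by
      rw [chainUnit, chainUnit, map_mul, map_emb_chainUnit hF (by omega),
        map_emb_siteUnit hF (by omega)]

theorem qtrs_conj (hF : IsUnit F) (hΨ : IsClosedPair F Ψ) (hYB : YB F) {p : ℕ} :
    ∀ (i : ℕ) (X : Op N A (p + i)),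
      qtrs (Dmat Ψ) (p + 1) i (castOp (by omega : p + i + 1 = p + 1 + i)
        ((chainUnit A hF (p + i + 1) p i).val * emb X *
          (chainUnit A hF (p + i + 1) p i)⁻¹.val)) =
        emb (qtrs (Dmat Ψ) p i X)
  | 0, X => by
      simp only [chainUnit, inv_one, Units.val_one, one_mul, mul_one]
      rfl
  | i + 1, X => by
      have ih := qtrs_conj hF hΨ hYB i (qtr1 (Dmat Ψ) X)
      refine Eq.trans ?_ ih
      rw [qtrs]
      refine congrArg _ ?_
      have e1 := qtr1_castOp (Dmat Ψ) (by omega : p + i + 1 = p + 1 + i)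
        ((chainUnit A hF (p + i + 2) p (i + 1)).val * emb (m := p + i + 1) X *
          (chainUnit A hF (p + i + 2) p (i + 1))⁻¹.val)
      refine e1.trans (congrArg _ ?_)
      rw [chainUnit, ← map_emb_chainUnit hF (by omega), mul_inv_rev, Units.val_mul, Units.val_mul,
        ← map_inv, siteUnit_val, siteUnit_inv]
      have e2 : ∀ (U V : Op N A (p + i + 1)) (P Q : Op N A (p + i + 2)),
          qtr1 (Dmat Ψ) (emb U * P * emb (m := p + i + 1) X * (Q * emb V)) =
            U * qtr1 (Dmat Ψ) (P * emb (m := p + i + 1) X * Q) * V := fun U V P Q => by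
        rw [← qtr1_emb_mul, ← qtr1_mul_emb]
        simp only [mul_assoc]
      exact (e2 _ _ _ _).trans (by rw [qtr1_conj hF hΨ hYB])

theorem semiconj_chainUnit_site (h : YB F) (hF : IsUnit F) {X : M2 N K} (hX : RightCompat F X)
    {m p j : ℕ} (hp : p ≤ j) : ∀ {l : ℕ}, j + 1 < p + l → p + l < m →
    SemiconjBy (chainUnit A hF m p l : Op N A m) (sc A (site m j X)) (sc A (site m (j + 1) X))
  | 0, h1, _ => by omega
  | l + 1, h1, h2 => by
      rcases Nat.lt_or_ge (j + 1) (p + l) with h' | h'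
      · have h3 := semiconj_chainUnit_site h hF hX (m := m) hp h' (by omega)
        have h4 : Commute (sc A (site m (p + l) F)) (sc A (site m j X)) :=
          (commute_sc_site h' (by omega) X F).symm
        exact h3.mul_left h4
      · obtain ⟨t, rfl⟩ : ∃ t, j = p + t := ⟨j - p, by omega⟩
        obtain rfl : l = t + 1 := by omega
        have h3 : ∀ s, s ≤ t → SemiconjBy (chainUnit A hF m p s : Op N A m)
            (sc A (site m (p + t + 1) X)) (sc A (site m (p + t + 1) X)) := by
          intro s hs
          induction s with
          | zero => exact SemiconjBy.one_left _
          | succ s ih =>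
            have h5 : Commute (sc A (site m (p + s) F)) (sc A (site m (p + t + 1) X)) :=
              commute_sc_site (by omega) (by omega) F X
            exact (ih (by omega)).mul_left h5
        have h4 := hX.semiconj (A := A) (m := m) (i := p + t) (by omega)
        have e : ((chainUnit A hF m p (t + 1 + 1) : (Op N A m)ˣ) : Op N A m) =
            (chainUnit A hF m p t : (Op N A m)ˣ) *
              (sc A (site m (p + t) F) * sc A (site m (p + t + 1) F)) := mul_assoc _ _ _
        exact e ▸ (h3 t le_rfl).mul_left h4

theorem semiconj_chainUnit_Mb (h : YB F) (hF : IsUnit F) {m p j : ℕ} (hp : p ≤ j) :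
    ∀ {l : ℕ}, j < p + l → p + l < m →
    SemiconjBy (chainUnit A hF m p l : Op N A m) (Mb F M m j) (Mb F M m (j + 1))
  | 0, h1, _ => by omega
  | l + 1, h1, h2 => by
      rcases Nat.lt_or_ge j (p + l) with h' | h'
      · have h3 := semiconj_chainUnit_Mb h hF (m := m) hp h' (by omega)
        have h4 : Commute (sc A (site m (p + l) F)) (Mb F M m j) :=
          commute_Mb_right F M h' (by omega) F
        exact h3.mul_left h4
      · obtain rfl : j = p + l := by omega
        have h3 : ∀ s, s ≤ l → SemiconjBy (chainUnit A hF m p s : Op N A m)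
            (Mb F M m (p + l + 1)) (Mb F M m (p + l + 1)) := by
          intro s hs
          induction s with
          | zero => exact SemiconjBy.one_left _
          | succ s ih =>
            have h5 : Commute (sc A (site m (p + s) F)) (Mb F M m (p + l + 1)) :=
              commute_Mb_left M hF h.leftCompat.rel (by omega) (by omega)
            exact (ih (by omega)).mul_left h5
        have h4 : SemiconjBy (siteUnit A hF m (p + l) : Op N A m) (Mb F M m (p + l))
            (Mb F M m (p + l + 1)) := by
          rw [Mb_succ, ← siteUnit_val hF, ← siteUnit_inv hF, SemiconjBy, mul_assoc,
            Units.inv_mul, mul_one]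
        exact (h3 l le_rfl).mul_left h4

/-- The antisymmetrized product `A^{(i)} M ⋯ M` at the factors `p, …, p+i-1`. -/
def asymMseg (q : K) (R F : M2 N K) (M : Matrix (Fin N) (Fin N) A) (m p i : ℕ) : Op N A m :=
  sc A (qasym q R m p i) * Mseg F M m p i

theorem semiconj_chainUnit_asymMseg (q : K) (h : Compatible R F) (hF : IsUnit F) {m p i : ℕ}
    (hm : p + i < m) : SemiconjBy (chainUnit A hF m p i : Op N A m) (asymMseg q R F M m p i)
      (asymMseg q R F M m (p + 1) i) := by
  refine SemiconjBy.mul_right ?_ ?_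
  · rw [qasym_eq_hasym, qasym_eq_hasym, map_hasym, map_hasym]
    refine hasym_semiconj q _ _ _ i fun j hj => ?_
    rw [add_right_comm]
    exact semiconj_chainUnit_site h.2.1 hF h.right (by omega) (by omega) (by omega)
  · have : ∀ l, l ≤ i → SemiconjBy (chainUnit A hF m p i : Op N A m) (Mseg F M m p l)
        (Mseg F M m (p + 1) l) := by
      intro l hl
      induction l with
      | zero => exact SemiconjBy.one_right _
      | succ l ih =>
        have h1 := semiconj_chainUnit_Mb (M := M) h.2.1 hF (m := m) (p := p) (j := p + l)
          (by omega) (l := i) (by omega) (by omega)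
        rw [add_right_comm] at h1
        exact (ih (by omega)).mul_right h1
    exact this i le_rfl

theorem emb_qasym (q : K) {m p k : ℕ} (h : p + k ≤ m) :
    emb (sc A (qasym q R m p k)) = sc A (qasym q R (m + 1) p k) := by
  rw [qasym_eq_hasym, qasym_eq_hasym]
  refine hasym_rel q (fun x y => emb (sc A x) = sc A y) ?_ ?_ ?_ ?_ _ _ k fun i hi => ?_
  · rw [map_one, map_one, map_one]
  · intro x y x' y' h1 h2
    rw [map_mul, map_mul, map_mul, h1, h2]
  · intro x y x' y' h1 h2
    rw [map_sub, map_sub, map_sub, h1, h2]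
  · intro c x y h1
    rw [emb_sc] at h1 ⊢
    rw [emb_smul, map_smul, map_smul, h1]
  · rw [emb_sc, emb_site (by omega)]

theorem emb_asymMseg (q : K) {m p i : ℕ} (h : p + i ≤ m) :
    emb (asymMseg q R F M m p i) = asymMseg q R F M (m + 1) p i := by
  rw [asymMseg, asymMseg, map_mul, emb_qasym q h, emb_Mseg h]

/-- The elementary symmetric functions do not depend on the place where they are computed. -/
theorem qtrs_asymMseg (q : K) (h : Compatible R F) (hF : IsUnit F) (hΨ : IsClosedPair F Ψ)
    (i : ℕ) : ∀ p, qtrs (Dmat Ψ) p i (asymMseg q R F M (p + i) p i) = sigmaF q R F Ψ M i • 1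
  | 0 => by
      rw [eq_qtrAll_smul_one (Dmat Ψ) (qtrs (Dmat Ψ) 0 i _), qtrAll_qtrs]
      have : ∀ m, m = i → qtrAll (Dmat Ψ) (asymMseg q R F M m 0 i) = sigmaF q R F Ψ M i := by
        rintro _ rfl
        rfl
      rw [this _ (by omega)]
  | p + 1 => by
      have e := qtrs_conj hF hΨ h.2.1 i (asymMseg q R F M (p + i) p i)
      rw [qtrs_asymMseg q h hF hΨ i p, emb_smul_one, emb_asymMseg q le_rfl,
        (semiconj_chainUnit_asymMseg q h hF (by omega)).eq, Units.mul_inv_cancel_right,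
        castOp_eq _ fun m => asymMseg q R F M m (p + 1) i] at e
      exact e

end Shifts

noncomputable section Recursion

variable {K : Type*} [Field K] {A : Type*} [Ring A] [Algebra K A] {N : ℕ}
variable {q : K} {R F Ψ : M2 N K} {M : Matrix (Fin N) (Fin N) A}

theorem emb_chain {m p : ℕ} : ∀ {l : ℕ}, p + l < m →
    emb (chain m R p l) = chain (m + 1) R p l
  | 0, _ => map_one _
  | l + 1, h => by
      rw [chain, chain, map_mul, emb_chain (by omega), emb_site (by omega)]

theorem embs_chain_Mseg (F : M2 N K) (M : Matrix (Fin N) (Fin N) A) (m j l : ℕ) (hj : j < m)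
    (hl : l ≤ m) : ∀ i, embs i (sc A (chain m R 0 j) * Mseg F M m 0 l) =
      sc A (chain (m + i) R 0 j) * Mseg F M (m + i) 0 l
  | 0 => rfl
  | i + 1 => by
      have e := emb_chain (R := R) (m := m + i) (p := 0) (l := j) (by omega)
      refine (congrArg emb (embs_chain_Mseg F M m j l hj hl i)).trans ?_
      rw [map_mul, emb_sc, emb_Mseg (by omega), e]
      rfl

theorem MpowF_mul_sigmaF (q : K) (h : Compatible R F) (hF : IsUnit F) (hΨ : IsClosedPair F Ψ)
    (j i : ℕ) :
    MpowF R F Ψ M j * (sigmaF q R F Ψ M i • (1 : Op N A 1)) =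
      qtrs (Dmat Ψ) 1 (j + i) (sc A (chain (1 + (j + i)) R 0 j) *
        sc A (qasym q R (1 + (j + i)) (j + 1) i) * Mseg F M (1 + (j + i)) 0 (j + i + 1)) := by
  have hc : Commute (sc A (qasym q R (1 + (j + i)) (j + 1) i))
      (Mseg F M (1 + (j + i)) 0 (j + 1)) := by
    rw [qasym_eq_hasym, map_hasym]
    exact (hasym_commute q _ _ i fun t ht =>
      (commute_Mseg_right (by omega) R (by omega)).symm).symm
  have e1 : sc A (chain (1 + (j + i)) R 0 j) * sc A (qasym q R (1 + (j + i)) (j + 1) i) *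
      Mseg F M (1 + (j + i)) 0 (j + i + 1) =
      sc A (chain (1 + (j + i)) R 0 j) * Mseg F M (1 + (j + i)) 0 (j + 1) *
        asymMseg q R F M (1 + (j + i)) (1 + j) i := by
    rw [add_right_comm, Mseg_add, zero_add, asymMseg, add_comm 1 j, mul_assoc, ← mul_assoc _ _ (Mseg _ _ _ _ i),
      hc.eq]
    simp only [mul_assoc]
  rw [e1, qtrs_castOp, castOp_eq _ fun m => sc A (chain m R 0 j) * Mseg F M m 0 (j + 1) *
        asymMseg q R F M m (1 + j) i, ← embs_chain_Mseg F M (1 + j) j (j + 1) (by omega) (by omega),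
    qtrs_embs_mul, qtrs_asymMseg q h hF hΨ, MpowF, chain_map]
  have e2 : ∀ (k : ℕ) (X : Op N A (1 + k)) (s : A), qtrs (Dmat Ψ) 1 k X * (s • (1 : Op N A 1)) =
      qtrs (Dmat Ψ) 1 k (X * (s • 1)) := by
    intro k
    induction k with
    | zero => exact fun X s => rfl
    | succ k ih =>
      intro X s
      have e3 := qtr1_mul_emb (Dmat Ψ) (s • (1 : Op N A (1 + k))) X
      rw [emb_smul_one] at e3
      exact (ih _ s).trans (congrArg (qtrs (Dmat Ψ) 1 k) e3.symm)
  exact e2 _ _ _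

theorem IsHecke.heckeRel (hH : IsHecke q R) {m p n : ℕ} (hn : p + n < m) :
    HeckeRel q (fun i => site m (p + i) R) n := by
  have h1 : R * R = 1 + (q - q⁻¹) • R := hH.2.2
  have h2 : site 3 0 R * site 3 1 R * site 3 0 R = site 3 1 R * site 3 0 R * site 3 1 R := hH.2.1
  refine ⟨fun i hi => ?_, fun i hi => ?_, fun i j hij hj => ?_⟩
  · change site m (p + i) R * site m (p + i) R = 1 + (q - q⁻¹) • site m (p + i) R
    rw [← site_mul', h1, site_add (by omega), site_one, site_smul (by omega)]
  · have h3 := three_transport (A := K) (m := m) (i := p + i) (s := 0) (t := 1) (u := 0)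
      (s' := 1) (t' := 0) (u' := 1) (by omega) h2
    simp only [Fin.isValue, Fin.val_one, Fin.val_zero, add_zero, sc_self] at h3
    simp only [← add_assoc]
    exact h3
  · exact commute_site (by omega) (by omega) R R

theorem qasym_mirror (hq0 : q ≠ 0) (hq : q - q⁻¹ ≠ 0) (hqn : ∀ n : ℕ, 1 ≤ n → qInt q n ≠ 0)
    (hH : IsHecke q R) {m p k : ℕ} (hk : p + k + 1 < m) :
    qInt q (k + 2) • qasym q R m p (k + 2) =
      qasym q R m (p + 1) (k + 1) * (q ^ (k + 1) • 1 - qInt q (k + 1) • site m p R) *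
        qasym q R m (p + 1) (k + 1) := by
  rw [qasym_eq_hasym, qasym_eq_hasym, hasym_mirror hq0 hq hqn k (hH.heckeRel (by omega)),
    smul_inv_smul₀ (hqn _ (by omega)), add_zero]
  have e : (fun i => site m (p + (i + 1)) R) = fun i => site m (p + 1 + i) R :=
    funext fun i => by rw [add_right_comm, add_assoc]
  rw [e]

theorem qasym_idem (hq0 : q ≠ 0) (hq : q - q⁻¹ ≠ 0) (hqn : ∀ n : ℕ, 1 ≤ n → qInt q n ≠ 0)
    (hH : IsHecke q R) {m p k : ℕ} (hk : p + k ≤ m) :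
    qasym q R m p k * qasym q R m p k = qasym q R m p k := by
  rw [qasym_eq_hasym]
  rcases k with _ | k
  · exact mul_one _
  · exact hasym_idem hq0 hq hqn (hH.heckeRel (n := k) (by omega)) _ le_rfl

/-- Partially antisymmetrized powers of `M`. -/
def mixedPow (q : K) (R F Ψ : M2 N K) (M : Matrix (Fin N) (Fin N) A) (n j p i : ℕ) : Op N A 1 :=
  qtrs (Dmat Ψ) 1 n (sc A (chain (1 + n) R 0 j) * sc A (qasym q R (1 + n) p i) *
    Mseg F M (1 + n) 0 (n + 1))

theorem mixedPow_recursion (hq0 : q ≠ 0) (hq : q - q⁻¹ ≠ 0)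
    (hqn : ∀ n : ℕ, 1 ≤ n → qInt q n ≠ 0) (hH : IsHecke q R) (h : Compatible R F)
    (hF : IsUnit F) (hΨ : IsClosedPair F Ψ) (hM : IsGenerators R F M) {n j i : ℕ}
    (hn : j + (i + 1) = n) :
    qInt q (i + 2) • mixedPow q R F Ψ M n j j (i + 2) =
      q ^ (i + 1) • mixedPow q R F Ψ M n j (j + 1) (i + 1) -
        qInt q (i + 1) • mixedPow q R F Ψ M n (j + 1) (j + 1) (i + 1) := by
  set m := 1 + n with hm
  set a := sc A (qasym q R m (j + 1) (i + 1)) with ha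
  set S := Mseg F M m 0 (n + 1)
  have hidem : a * a = a := by
    rw [ha, ← map_mul, qasym_idem hq0 hq hqn hH (by omega)]
  have hcomm : Commute (sc A (chain m R 0 j)) a := by
    have : ∀ l, l ≤ j → Commute (sc A (chain m R 0 l)) a := by
      intro l hl
      induction l with
      | zero => rw [chain, map_one]; exact Commute.one_left _
      | succ l ih =>
        rw [chain, map_mul]
        refine (ih (by omega)).mul_left ?_
        rw [ha, qasym_eq_hasym, map_hasym]
        exact hasym_commute q _ _ _ fun t ht => commute_sc_site (by omega) (by omega) R R
    exact this j le_rfl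
  have hcyc : ∀ X, qtrs (Dmat Ψ) 1 n (a * (X * (a * S))) = qtrs (Dmat Ψ) 1 n (X * (a * S)) := by
    intro X
    rw [ha, qtrs_qasym_cyclic (Dmat Ψ) (kronecker_Dmat_mul hF hΨ h) q (by omega) (by omega),
      mul_assoc, mul_assoc, (semiconj_Mseg_qasym h hF hM q (by omega) (by omega) (by omega)).eq,
      ← ha, ← mul_assoc a a, hidem]
  have key : qInt q (i + 2) • (sc A (chain m R 0 j) * sc A (qasym q R m j (i + 2)) * S) =
      q ^ (i + 1) • (sc A (chain m R 0 j) * a * S) -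
        qInt q (i + 1) • (a * (sc A (chain m R 0 (j + 1)) * (a * S))) := by
    rw [← smul_mul_assoc, ← mul_smul_comm, ← map_smul, qasym_mirror hq0 hq hqn hH (by omega),
      map_mul, map_mul, ← ha, map_sub, map_smul, map_smul, map_one, chain, map_mul, zero_add,
      mul_sub, sub_mul, mul_sub, sub_mul, mul_smul_comm, mul_smul_comm, smul_mul_assoc,
      smul_mul_assoc, mul_smul_comm, mul_smul_comm, smul_mul_assoc, smul_mul_assoc, mul_one, hidem]
    congr 2
    rw [← mul_assoc a, ← mul_assoc a, ← hcomm.eq]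
    simp only [mul_assoc]
  rw [mixedPow, mixedPow, mixedPow, ← qtrs_smul, key, qtrs_sub, qtrs_smul, qtrs_smul, hcyc,
    ← mul_assoc]

theorem sum_mixedPow (hq0 : q ≠ 0) (hq : q - q⁻¹ ≠ 0)
    (hqn : ∀ n : ℕ, 1 ≤ n → qInt q n ≠ 0) (hH : IsHecke q R) (h : Compatible R F)
    (hF : IsUnit F) (hΨ : IsClosedPair F Ψ) (hM : IsGenerators R F M) (n : ℕ) :
    ∀ l, l ≤ n → ∑ i ∈ Finset.range (l + 1), (-q) ^ i • mixedPow q R F Ψ M n (n - i) (n - i + 1) i =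
      ((-1) ^ l * qInt q (l + 1)) • mixedPow q R F Ψ M n (n - l) (n - l) (l + 1)
  | 0, _ => by
      rw [Finset.sum_range_one, zero_add, qInt_one hq, mul_one, pow_zero, pow_zero]
      rfl
  | l + 1, hl => by
      obtain ⟨j, rfl⟩ : ∃ j, n = j + (l + 1) := ⟨n - (l + 1), by omega⟩
      rw [Finset.sum_range_succ, sum_mixedPow hq0 hq hqn hH h hF hΨ hM _ l (by omega)]
      have e := mixedPow_recursion hq0 hq hqn hH h hF hΨ hM (j := j) (i := l) rfl
      rw [show j + (l + 1) - l = j + 1 by omega, Nat.add_sub_cancel, mul_smul _ _ (mixedPow _ _ _ _ _ _ j _ _), e, neg_pow,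
        pow_succ (-1 : K) l, mul_smul, smul_sub, smul_smul, smul_smul, smul_smul]
      module

theorem sum_MpowF_mul_sigmaF (hq0 : q ≠ 0) (hq : q - q⁻¹ ≠ 0)
    (hqn : ∀ n : ℕ, 1 ≤ n → qInt q n ≠ 0) (hH : IsHecke q R) (h : Compatible R F)
    (hF : IsUnit F) (hΨ : IsClosedPair F Ψ) (hM : IsGenerators R F M) (n : ℕ) :
    ∑ i ∈ Finset.range (n + 1), (-q) ^ i •
      (MpowF R F Ψ M (n - i) * (sigmaF q R F Ψ M i • (1 : Op N A 1))) =
      ((-1) ^ n * qInt q (n + 1)) • MwedgeF q R F Ψ M n := by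
  have e := sum_mixedPow (M := M) hq0 hq hqn hH h hF hΨ hM n n le_rfl
  have e1 : mixedPow q R F Ψ M n (n - n) (n - n) (n + 1) = MwedgeF q R F Ψ M n := by
    rw [Nat.sub_self, mixedPow, chain, map_one, one_mul]
    rfl
  rw [e1] at e
  rw [← e]
  refine Finset.sum_congr rfl fun i hi => ?_
  have hi' : n - i + i = n := by
    have := Finset.mem_range.1 hi
    omega
  rw [MpowF_mul_sigmaF q h hF hΨ (n - i) i]
  have e2 : ∀ n', n - i + i = n' → qtrs (Dmat Ψ) 1 (n - i + i)
      (sc A (chain (1 + (n - i + i)) R 0 (n - i)) *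
        sc A (qasym q R (1 + (n - i + i)) (n - i + 1) i) *
          Mseg F M (1 + (n - i + i)) 0 (n - i + i + 1)) =
      mixedPow q R F Ψ M n' (n - i) (n - i + 1) i := by
    intro n' hn'
    rw [← hn', mixedPow]
  rw [e2 n hi']

end Recursion

section RankOne

variable {K : Type*} [Field K] {ι : Type*} [Fintype ι]

theorem dotProduct_eq_one_of_idem {u v : ι → K}
    (hidem : Matrix.vecMulVec u v * Matrix.vecMulVec u v = Matrix.vecMulVec u v)
    (h : Matrix.vecMulVec u v ≠ 0) : ∑ i, u i * v i = 1 := by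
  have h' : ∃ i j, u i * v j ≠ 0 := by
    by_contra! h0
    exact h (Matrix.ext h0)
  obtain ⟨i, j, hij⟩ := h'
  have := congrArg (fun Y : Matrix ι ι K => Y i j) hidem
  simp only [Matrix.mul_apply, Matrix.vecMulVec_apply] at this
  have e : (∑ x, u i * v x * (u x * v j)) = (u i * v j) * ∑ x, u x * v x := by
    rw [Finset.mul_sum]
    exact Finset.sum_congr rfl fun x _ => by ring
  rw [e] at this
  exact mul_left_cancel₀ hij (this.trans (mul_one _).symm)

theorem exists_eq_vecMulVec_of_rank_eq_one [DecidableEq ι] {X : Matrix ι ι K} (h : X.rank = 1) :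
    ∃ u v : ι → K, X = Matrix.vecMulVec u v := by
  rw [Matrix.rank, finrank_eq_one_iff'] at h
  obtain ⟨u, -, hu⟩ := h
  choose c hc using fun j : ι => hu ⟨X.mulVec (Pi.single j 1), LinearMap.mem_range_self X.mulVecLin _⟩
  refine ⟨u, c, ?_⟩
  ext i j
  have := congrFun (congrArg Subtype.val (hc j)) i
  simp only [Submodule.coe_smul, Pi.smul_apply, smul_eq_mul, Matrix.mulVec_single_one,
    Matrix.col_apply] at this
  rw [Matrix.vecMulVec_apply, ← this, mul_comm]

end RankOne

noncomputable section WeightedTrace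

variable {K : Type*} [Field K] {A : Type*} [Ring A] [Algebra K A] {N : ℕ}

/-- The tensor power of the matrix `D`. -/
def Dpow (D : Matrix (Fin N) (Fin N) K) (m : ℕ) : Op N K m := fun a b => ∏ i, D (a i) (b i)

variable (D : Matrix (Fin N) (Fin N) K)

theorem Dpow_snoc {m : ℕ} (a b : Fin m → Fin N) (c d : Fin N) :
    Dpow D (m + 1) (Fin.snoc a c) (Fin.snoc b d) = Dpow D m a b * D c d := by
  simp only [Dpow, Fin.prod_univ_castSucc, Fin.snoc_castSucc, Fin.snoc_last]

theorem site1_one_mul (X Y : Matrix (Fin N) (Fin N) K) :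
    site1 1 0 X * site1 1 0 Y = site1 1 0 (X * Y) := by
  ext a b
  simp only [Matrix.mul_apply, site1]
  rw [← (Equiv.funUnique (Fin 1) (Fin N)).symm.sum_comp]
  simp

theorem site1_one_one : site1 1 0 (1 : Matrix (Fin N) (Fin N) K) = 1 := by
  ext a b
  have e : a = b ↔ a 0 = b 0 := by
    rw [funext_iff, Fin.forall_fin_one]
  simp [site1, Matrix.one_apply, e]

theorem Dpow_one : Dpow D 1 = site1 1 0 D := by
  ext a b
  simp [Dpow, site1]

theorem qtrAll_eq_trace {m : ℕ} (X : Op N A m) :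
    qtrAll D X = Matrix.trace (X * sc A (Dpow D m)) := by
  simp only [qtrAll, Matrix.trace, Matrix.diag, Matrix.mul_apply, sc_apply, Dpow]
  rw [Finset.sum_comm]
  exact Finset.sum_congr rfl fun b _ => Finset.sum_congr rfl fun a _ => Algebra.commutes _ _

theorem qtr1_mul_Dpow {m : ℕ} (X : Op N A (m + 1)) :
    qtr1 D X * sc A (Dpow D m) = ptr1 (X * sc A (Dpow D (m + 1))) := by
  ext a b
  rw [Matrix.mul_apply]
  simp only [ptr1, mul_apply_snoc, qtr1, sc_apply, Dpow_snoc, map_mul, Finset.sum_mul]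
  refine (sum_rotate _).trans (Finset.sum_congr rfl fun e _ => Finset.sum_congr rfl fun x _ =>
    Finset.sum_congr rfl fun c _ => ?_)
  rw [mul_assoc, Algebra.commutes, mul_assoc]

theorem qtrs_mul_Dpow {m : ℕ} : ∀ (j : ℕ) (X : Op N A (m + j)),
    qtrs D m j X * sc A (Dpow D m) = ptrs m j (X * sc A (Dpow D (m + j)))
  | 0, _ => rfl
  | j + 1, X => (qtrs_mul_Dpow j (qtr1 D X)).trans (congrArg (ptrs m j) (qtr1_mul_Dpow D X))

theorem Dpow_add_two (m : ℕ) :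
    Dpow D (m + 2) = emb (emb (Dpow D m)) * site (m + 2) m (Matrix.kronecker D D) := by
  refine op_ext fun a b c d => ?_
  rw [← Fin.snoc_init_self a, ← Fin.snoc_init_self b, mul_site_last_apply, Dpow_snoc, Dpow_snoc]
  simp only [emb_apply_snoc]
  simp [mul_assoc]

theorem semiconj_Dpow_site {R R' : M2 N K}
    (hD : Matrix.kronecker D D * R = R' * Matrix.kronecker D D) {m i : ℕ} (hi : i + 1 < m) :
    SemiconjBy (Dpow D m) (site m i R) (site m i R') := by
  refine site_induction
    (P := fun m i => SemiconjBy (Dpow D m) (site m i R) (site m i R')) ?_ ?_ hi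
  · intro m
    have hc : Commute (site (m + 2) m R') (emb (emb (Dpow D m))) := commute_last (Dpow D m) R'
    rw [Dpow_add_two]
    refine SemiconjBy.mul_left hc.symm ?_
    rw [SemiconjBy, ← site_mul', ← site_mul', hD]
  · intro m i hi ih
    rw [← emb_site hi, ← emb_site hi]
    refine op_ext fun a b c d => ?_
    rw [emb_mul_apply, mul_emb_apply]
    simp only [Dpow_snoc]
    have := congrArg (fun X : Op N K m => X a b * D c d) ih.eq
    simp only [Matrix.mul_apply, Finset.sum_mul] at this
    rw [← Finset.sum_congr rfl fun x _ => mul_assoc _ _ _, ← this]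
    exact Finset.sum_congr rfl fun x _ => by ring

theorem semiconj_Dpow_qasym {R R' : M2 N K}
    (hD : Matrix.kronecker D D * R = R' * Matrix.kronecker D D) (q : K) {m p k : ℕ}
    (hk : p + k ≤ m) : SemiconjBy (Dpow D m) (qasym q R m p k) (qasym q R' m p k) := by
  rw [qasym_eq_hasym, qasym_eq_hasym]
  exact hasym_semiconj q _ _ _ k fun i hi => semiconj_Dpow_site D hD (by omega)

theorem ptrs_smul_sc {m : ℕ} (s : A) : ∀ (j : ℕ) (X : Op N K (m + j)),
    ptrs m j (s • sc A X) = s • sc A (ptrs m j X)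
  | 0, _ => rfl
  | j + 1, X => by
      have e : ptr1 (s • sc A X) = s • sc A (ptr1 X) := by
        ext a b
        simp only [ptr1, Matrix.smul_apply, sc_apply, map_sum, Finset.smul_sum]
      exact (congrArg (ptrs m j) e).trans (ptrs_smul_sc s j (ptr1 X))

theorem sc_mul_smul_one {m : ℕ} (X : Op N K m) (s : A) :
    sc A X * (s • (1 : Op N A m)) = s • sc A X := by
  ext a b
  rw [Matrix.mul_apply, Finset.sum_eq_single b]
  · simp [sc_apply, Algebra.commutes]
  · intro c _ hc
    simp [Matrix.one_apply_ne hc]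
  · simp

end WeightedTrace

noncomputable section Wedge

variable {K : Type*} [Field K] {A : Type*} [Ring A] [Algebra K A] {N : ℕ}
variable {q : K} {R F Ψ : M2 N K} {M : Matrix (Fin N) (Fin N) A}

theorem swap_scalars (r s t w : K) (x : A) :
    algebraMap K A r * algebraMap K A s * x * (algebraMap K A t * algebraMap K A w) =
      algebraMap K A s * x * algebraMap K A t * (algebraMap K A r * algebraMap K A w) := by
  rw [← map_mul, mul_comm r s, map_mul]
  simp only [mul_assoc]
  rw [← mul_assoc x, ← mul_assoc (algebraMap K A r), Algebra.commutes r (x * algebraMap K A t)]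
  simp only [mul_assoc]

/-- A rank one idempotent with scalar entries compresses every operator to a multiple of it. -/
theorem compress_eq_trace_smul {m : ℕ} {P : Op N K m} (hP : P.rank = 1) (hidem : P * P = P)
    (X : Op N A m) :
    sc A P * X * sc A P = Matrix.trace (sc A P * X * sc A P) • sc A P := by
  obtain ⟨u, v, rfl⟩ := exists_eq_vecMulVec_of_rank_eq_one hP
  have huv := dotProduct_eq_one_of_idem hidem (by
    intro h0
    rw [h0, Matrix.rank_zero] at hP
    exact zero_ne_one hP)
  obtain ⟨z, hz⟩ : ∃ z : A, sc A (Matrix.vecMulVec u v) * X * sc A (Matrix.vecMulVec u v) =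
      z • sc A (Matrix.vecMulVec u v) := by
    refine ⟨∑ y, ∑ x, algebraMap K A (v x) * X x y * algebraMap K A (u y), ?_⟩
    ext a b
    simp only [Matrix.mul_apply, Matrix.smul_apply, sc_apply, Matrix.vecMulVec_apply, map_mul,
      Finset.sum_mul, smul_eq_mul]
    refine Finset.sum_congr rfl fun y _ => Finset.sum_congr rfl fun x _ => ?_
    exact swap_scalars _ _ _ _ _
  have ht : Matrix.trace (z • sc A (Matrix.vecMulVec u v)) = z := by
    simp only [Matrix.trace, Matrix.diag, Matrix.smul_apply, sc_apply, Matrix.vecMulVec_apply,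
      smul_eq_mul]
    rw [← Finset.mul_sum, ← map_sum, huv, map_one, mul_one]
  rw [hz, ht]

theorem MwedgeF_eq (hq0 : q ≠ 0) (hq : q - q⁻¹ ≠ 0)
    (hqn : ∀ n : ℕ, 1 ≤ n → qInt q n ≠ 0) (hH : IsHecke q R) (h : Compatible R F)
    (hF : IsUnit F) (hΨ : IsClosedPair F Ψ) (hM : IsGenerators R F M) (n : ℕ)
    (hrank : (qasym q R (n + 1) 0 (n + 1)).rank = 1) (hD : IsUnit (Dmat Ψ)) :
    MwedgeF q R F Ψ M n = sigmaF q R F Ψ M (n + 1) •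
      sc A (ptrs 1 n (qasym q R (1 + n) 0 (n + 1)) * site1 1 0 (Dmat Ψ)⁻¹) := by
  have hr : ∀ m, m = n + 1 → (qasym q R m 0 (n + 1)).rank = 1 ∧
      qtrAll (Dmat Ψ) (asymMseg q R F M m 0 (n + 1)) = sigmaF q R F Ψ M (n + 1) := by
    rintro _ rfl
    exact ⟨hrank, rfl⟩
  obtain ⟨hr1, hr2⟩ := hr (1 + n) (add_comm _ _)
  have hidem := qasym_idem hq0 hq hqn hH (m := 1 + n) (p := 0) (k := n + 1) (by omega)
  have hsc : sc A (qasym q R (1 + n) 0 (n + 1)) * sc A (qasym q R (1 + n) 0 (n + 1)) =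
      sc A (qasym q R (1 + n) 0 (n + 1)) := by rw [← map_mul, hidem]
  have hcomp : asymMseg q R F M (1 + n) 0 (n + 1) * sc A (Dpow (Dmat Ψ) (1 + n)) =
      sc A (qasym q R (1 + n) 0 (n + 1)) * (Mseg F M (1 + n) 0 (n + 1) *
        sc A (Dpow (Dmat Ψ) (1 + n))) * sc A (qasym q R (1 + n) 0 (n + 1)) := by
    have h1 := (semiconj_Mseg_qasym h hF hM q (m := 1 + n) (p := 0) (l := n + 1) (p' := 0)
      (k := n + 1) le_rfl (by omega) (by omega)).eq
    have h2 := congrArg (sc A) (semiconj_Dpow_qasym (Dmat Ψ) (kronecker_Dmat_mul hF hΨ h) q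
      (m := 1 + n) (p := 0) (k := n + 1) (by omega)).eq
    rw [map_mul, map_mul] at h2
    rw [asymMseg, mul_assoc, mul_assoc, mul_assoc, h2, ← mul_assoc (Mseg _ _ _ _ _), h1,
      ← mul_assoc, ← mul_assoc, ← mul_assoc, hsc]
  have hσ : asymMseg q R F M (1 + n) 0 (n + 1) * sc A (Dpow (Dmat Ψ) (1 + n)) =
      sigmaF q R F Ψ M (n + 1) • sc A (qasym q R (1 + n) 0 (n + 1)) := by
    rw [hcomp, compress_eq_trace_smul hr1 hidem, ← hcomp, ← qtrAll_eq_trace, hr2]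
  have hw : MwedgeF q R F Ψ M n * sc A (Dpow (Dmat Ψ) 1) =
      sigmaF q R F Ψ M (n + 1) • sc A (ptrs 1 n (qasym q R (1 + n) 0 (n + 1))) := by
    rw [← ptrs_smul_sc, ← hσ, ← qtrs_mul_Dpow]
    rfl
  have hinv : Dpow (Dmat Ψ) 1 * site1 1 0 (Dmat Ψ)⁻¹ = 1 := by
    rw [Dpow_one, site1_one_mul, Matrix.mul_nonsing_inv _ ((Matrix.isUnit_iff_isUnit_det _).1 hD),
      site1_one_one]
  rw [map_mul, ← smul_mul_assoc, ← hw, mul_assoc, ← map_mul, hinv, map_one, mul_one]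

end Wedge

/-- Cayley–Hamilton theorem.  Let `R̂` be an even Hecke
R-matrix of height `n = n0 + 1` (i.e. `A^{(n+1)} = 0` and `rank A^{(n)} = 1`),
`F̂` a compatible closed R-matrix whose matrix `D` is invertible, and `M` a
matrix of generators of `M(R̂,F̂)`.  Then
`∑_{i=0}^{n} (−q)^i M^{\overline{n−i}} σ_i(M) = 0`, where
`M^{\overline{0}} := q^{−n} n_q Tr_{(2,…,n)}(A^{(n)}) D^{−1}` (ordinary trace). -/
theorem Cayley_Hamilton {K : Type} [Field K] {A : Type} [Ring A] [Algebra K A]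
    {N : ℕ} (q : K) (R F Ψ : M2 N K) (M : Matrix (Fin N) (Fin N) A)
    (hq0 : q ≠ 0) (hq1 : q ^ 2 ≠ 1) (hqn : ∀ n : ℕ, 1 ≤ n → qInt q n ≠ 0)
    (hH : IsHecke q R) (hF : IsUnit F) (hΨ : IsClosedPair F Ψ)
    (h : Compatible R F) (hM : IsGenerators R F M)
    (n0 : ℕ)
    (heven0 : qasym q R (n0 + 2) 0 (n0 + 2) = 0)
    (heven1 : (qasym q R (n0 + 1) 0 (n0 + 1)).rank = 1)
    (hD : IsUnit (Dmat Ψ)) :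
    (∑ i ∈ Finset.range (n0 + 1),
        ((-q) ^ i) •
          (MpowF R F Ψ M (n0 - i) * (sigmaF q R F Ψ M i • (1 : Op N A 1)))) +
      ((-q) ^ (n0 + 1)) •
        ((MzeroF q R Ψ n0).map (algebraMap K A) *
          (sigmaF q R F Ψ M (n0 + 1) • (1 : Op N A 1))) =
    (0 : Op N A 1) := by
  have hq : q - q⁻¹ ≠ 0 := fun h0 => hq1 (by
    rw [pow_two]
    nth_rewrite 1 [sub_eq_zero.1 h0]
    exact inv_mul_cancel₀ hq0)
  have hcoef : (-q) ^ (n0 + 1) * (q⁻¹ ^ (n0 + 1) * qInt q (n0 + 1)) =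
      -((-1) ^ n0 * qInt q (n0 + 1)) := by
    rw [← mul_assoc, ← mul_pow, neg_mul, mul_inv_cancel₀ hq0, pow_succ]
    ring
  rw [sum_MpowF_mul_sigmaF hq0 hq hqn hH h hF hΨ hM,
    MwedgeF_eq hq0 hq hqn hH h hF hΨ hM n0 heven1 hD, map_eq_sc, sc_mul_smul_one, MzeroF]
  set Z := ptrs 1 n0 (qasym q R (1 + n0) 0 (n0 + 1)) * site1 1 0 (Dmat Ψ)⁻¹
  have e : sc A ((q⁻¹ ^ (n0 + 1) * qInt q (n0 + 1)) • Z) =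
      (q⁻¹ ^ (n0 + 1) * qInt q (n0 + 1)) • sc A Z := by
    ext a b
    rw [sc_apply, Matrix.smul_apply, Matrix.smul_apply, sc_apply, smul_eq_mul, map_mul,
      Algebra.smul_def]
  rw [e, smul_comm (sigmaF q R F Ψ M (n0 + 1)) (_ : K), smul_smul, hcoef, neg_smul,
    add_neg_cancel]

end CHN
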